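/- arXiv:2004.08721 — 4 statements merged into one kernel-verified Lean document; each statement's English description precedes it below -/
import Mathlib

section
/- For all integers k > ℓ ≥ 1 and n ≥ k+ℓ, one has g(n+1,k,ℓ) ≥ g(n,k,ℓ) + C(n,k+ℓ−1)·C(k+ℓ−1,ℓ−1). -/
/-- `v` is a `{0,1,-1}`-vector of length `n` with exactly `k` coordinates equal to `+1`
and exactly `l` coordinates equal to `-1`, i.e. `v ∈ V(n,k,l)`. -/
def IsPMVec (n k l : ℕ) (v : Fin n → ℤ) : Prop :=
  (∀ i, v i = 0 ∨ v i = 1 ∨ v i = -1) ∧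
  (Finset.univ.filter fun i => v i = 1).card = k ∧
  (Finset.univ.filter fun i => v i = -1).card = l

/-- the standard scalar product -/
def dotZ {n : ℕ} (v w : Fin n → ℤ) : ℤ := ∑ i, v i * w i

/-- `g(n,k,l)`: the maximum size of a family `V ⊆ V(n,k,l)` with
`⟨v,w⟩ > -2l` for all `v, w ∈ V`. -/
noncomputable def gVal (n k l : ℕ) : ℕ :=
  sSup {m | ∃ F : Finset (Fin n → ℤ),
    (∀ v ∈ F, IsPMVec n k l v) ∧
    (∀ v ∈ F, ∀ w ∈ F, -2 * (l : ℤ) < dotZ v w) ∧ F.card = m}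

/-- The scalar product of two `{0,1,-1}`-vectors is at least minus their total number
of `-1` coordinates. -/
lemma IsPMVec.neg_add_le_dotZ {n k l k' l' : ℕ} {v w : Fin n → ℤ}
    (hv : IsPMVec n k l v) (hw : IsPMVec n k' l' w) : -((l : ℤ) + l') ≤ dotZ v w := by
  obtain ⟨hv, -, rfl⟩ := hv
  obtain ⟨hw, -, rfl⟩ := hw
  rw [Finset.card_filter, Finset.card_filter]
  push_cast
  rw [← Finset.sum_add_distrib, ← Finset.sum_neg_distrib, dotZ]
  refine Finset.sum_le_sum fun i _ => ?_
  rcases hv i with h | h | h <;> rcases hw i with h' | h' | h' <;> simp [h, h']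

lemma IsPMVec.cons_zero {n k l : ℕ} {v : Fin n → ℤ} (hv : IsPMVec n k l v) :
    IsPMVec (n + 1) k l (Fin.cons 0 v : Fin (n + 1) → ℤ) := by
  obtain ⟨hv, rfl, rfl⟩ := hv
  refine ⟨fun i => ?_, ?_, ?_⟩
  · cases i using Fin.cases <;> simp [hv]
  · simp [Fin.card_filter_univ_succ]
  · simp [Fin.card_filter_univ_succ]

lemma IsPMVec.cons_neg_one {n k l : ℕ} {v : Fin n → ℤ} (hv : IsPMVec n k l v) :
    IsPMVec (n + 1) k (l + 1) (Fin.cons (-1) v : Fin (n + 1) → ℤ) := by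
  obtain ⟨hv, rfl, rfl⟩ := hv
  refine ⟨fun i => ?_, ?_, ?_⟩
  · cases i using Fin.cases <;> simp [hv]
  · simp [Fin.card_filter_univ_succ]
  · simp [Fin.card_filter_univ_succ]

lemma dotZ_cons {n : ℕ} (a b : ℤ) (v w : Fin n → ℤ) :
    dotZ (Fin.cons a v : Fin (n + 1) → ℤ) (Fin.cons b w : Fin (n + 1) → ℤ) =
      a * b + dotZ v w := by
  simp [dotZ, Fin.sum_univ_succ]

lemma finite_setOf_isPMVec (n k l : ℕ) : {v | IsPMVec n k l v}.Finite := by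
  refine (Fintype.piFinset fun _ : Fin n => ({0, 1, -1} : Finset ℤ)).finite_toSet.subset ?_
  intro v hv
  simpa using hv.1

lemma bddAbove_card_family (n k l : ℕ) :
    BddAbove {m | ∃ F : Finset (Fin n → ℤ),
      (∀ v ∈ F, IsPMVec n k l v) ∧
      (∀ v ∈ F, ∀ w ∈ F, -2 * (l : ℤ) < dotZ v w) ∧ F.card = m} := by
  refine ⟨(finite_setOf_isPMVec n k l).toFinset.card, ?_⟩
  rintro _ ⟨F, hF, -, rfl⟩
  exact Finset.card_le_card fun v hv => by simpa using hF v hv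

lemma exists_card_eq_gVal (n k l : ℕ) :
    ∃ F : Finset (Fin n → ℤ), (∀ v ∈ F, IsPMVec n k l v) ∧
      (∀ v ∈ F, ∀ w ∈ F, -2 * (l : ℤ) < dotZ v w) ∧ F.card = gVal n k l := by
  refine Nat.sSup_mem ?_ (bddAbove_card_family n k l)
  exact ⟨0, ∅, by simp⟩

/-- The `{0,1,-1}`-vector with support `S` and `-1` exactly on `T ⊆ S`. -/
def signVec {n : ℕ} (S T : Finset (Fin n)) (i : Fin n) : ℤ :=
  if i ∈ T then -1 else if i ∈ S then 1 else 0

lemma filter_signVec_eq_neg_one {n : ℕ} (S T : Finset (Fin n)) :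
    (Finset.univ.filter fun i => signVec S T i = -1) = T := by
  ext i
  rw [Finset.mem_filter_univ, signVec]
  split_ifs <;> simp_all

lemma filter_signVec_eq_one {n : ℕ} (S T : Finset (Fin n)) :
    (Finset.univ.filter fun i => signVec S T i = 1) = S \ T := by
  ext i
  rw [Finset.mem_filter_univ, Finset.mem_sdiff, signVec]
  split_ifs <;> simp_all

lemma isPMVec_signVec {n : ℕ} {S T : Finset (Fin n)} (h : T ⊆ S) :
    IsPMVec n (S.card - T.card) T.card (signVec S T) := by
  refine ⟨fun i => ?_, ?_, ?_⟩
  · simp only [signVec]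
    split_ifs <;> simp
  · rw [filter_signVec_eq_one, Finset.card_sdiff_of_subset h]
  · rw [filter_signVec_eq_neg_one]

lemma exists_isPMVec_family (n k l : ℕ) :
    ∃ G : Finset (Fin n → ℤ), (∀ v ∈ G, IsPMVec n k l v) ∧
      G.card = n.choose (k + l) * (k + l).choose l := by
  classical
  refine ⟨((Finset.powersetCard (k + l) Finset.univ).sigma
    fun S : Finset (Fin n) => Finset.powersetCard l S).image fun p => signVec p.1 p.2, ?_, ?_⟩
  · simp only [Finset.mem_image, Finset.mem_sigma, Finset.mem_powersetCard]
    rintro _ ⟨⟨S, T⟩, ⟨⟨-, hS⟩, hTS, hT⟩, rfl⟩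
    simpa [hS, hT] using isPMVec_signVec hTS
  · rw [Finset.card_image_of_injOn, Finset.card_sigma, Finset.sum_congr rfl (fun S hS => by
      rw [Finset.card_powersetCard, (Finset.mem_powersetCard.1 hS).2])]
    · simp
    · rintro ⟨S, T⟩ hp ⟨S', T'⟩ hp' h
      simp only [Finset.mem_coe, Finset.mem_sigma, Finset.mem_powersetCard] at hp hp'
      replace h : signVec S T = signVec S' T' := h
      have hT : T = T' := by
        rw [← filter_signVec_eq_neg_one S T, h, filter_signVec_eq_neg_one]
      have hd : S \ T = S' \ T' := by
        rw [← filter_signVec_eq_one S T, h, filter_signVec_eq_one]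
      have hS : S = S' := by
        rw [← Finset.sdiff_union_of_subset hp.2.1, hd, hT,
          Finset.sdiff_union_of_subset hp'.2.1]
      rw [hS, hT]

/-- For all integers `k > l ≥ 1` and `n ≥ k + l`, one has
`g(n+1,k,l) ≥ g(n,k,l) + C(n,k+l-1)·C(k+l-1,l-1)`. -/
theorem stmt_12 (k l n : ℕ) (hl : 1 ≤ l) (hlk : l < k) (hn : k + l ≤ n) :
    gVal n k l + Nat.choose n (k + l - 1) * Nat.choose (k + l - 1) (l - 1) ≤
      gVal (n + 1) k l := by
  classical
  obtain ⟨l, rfl⟩ := Nat.exists_eq_add_of_le' hl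
  obtain ⟨F, hF, hdot, hcard⟩ := exists_card_eq_gVal n k (l + 1)
  obtain ⟨G, hG, hGcard⟩ := exists_isPMVec_family n k l
  refine le_csSup (bddAbove_card_family _ _ _)
    ⟨F.image (Fin.cons (0 : ℤ)) ∪ G.image (Fin.cons (-1 : ℤ)), ?_, ?_, ?_⟩
  · simp only [Finset.mem_union, Finset.mem_image]
    rintro _ (⟨v, hv, rfl⟩ | ⟨v, hv, rfl⟩)
    · exact (hF v hv).cons_zero
    · exact (hG v hv).cons_neg_one
  · simp only [Finset.mem_union, Finset.mem_image]
    rintro _ (⟨v, hv, rfl⟩ | ⟨v, hv, rfl⟩) _ (⟨w, hw, rfl⟩ | ⟨w, hw, rfl⟩) <;>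
      rw [dotZ_cons]
    · simpa using hdot v hv w hw
    · have := (hF v hv).neg_add_le_dotZ (hG w hw)
      push_cast at this ⊢
      linarith
    · have := (hG v hv).neg_add_le_dotZ (hF w hw)
      push_cast at this ⊢
      linarith
    · have := (hG v hv).neg_add_le_dotZ (hG w hw)
      push_cast at this ⊢
      linarith
  · rw [Finset.card_union_of_disjoint, Finset.card_image_of_injective _ (Fin.cons_right_injective _),
      Finset.card_image_of_injective _ (Fin.cons_right_injective _), hcard, hGcard]
    · simp [← add_assoc]
    · simp only [Finset.disjoint_left, Finset.mem_image]
      rintro _ ⟨v, -, rfl⟩ ⟨w, -, h⟩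
      simpa using congrFun h 0
end

section
/- Let k > ℓ ≥ 1 be integers and set n₀ = (k+ℓ)·2^{k+ℓ+2}. For every integer n ≥ n₀, one has 2·m(n,k,ℓ) ≤ max{ 2·p(n,k,ℓ), 2·C(n₀,k)·C(n₀,ℓ) + p(n,k,ℓ) }. -/
/-- `m(n,k,l)`: the maximum size of a family `V ⊆ V(n,k,l)` with
`⟨v,w⟩ ≥ 0` for all `v, w ∈ V`. -/
noncomputable def mVal (n k l : ℕ) : ℕ :=
  sSup {m | ∃ F : Finset (Fin n → ℤ),
    (∀ v ∈ F, IsPMVec n k l v) ∧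
    (∀ v ∈ F, ∀ w ∈ F, 0 ≤ dotZ v w) ∧ F.card = m}

/-- `p(n,k,l) = max_{0 ≤ x ≤ n} C(x,k)·C(n-x,l)`. -/
def pVal (n k l : ℕ) : ℕ :=
  (Finset.range (n + 1)).sup fun x => Nat.choose x k * Nat.choose (n - x) l

lemma choose_mul_choose_le_pVal {n x y : ℕ} (k l : ℕ) (h : x + y = n) :
    x.choose k * y.choose l ≤ pVal n k l := by
  have hy : y = n - x := by omega
  subst hy
  exact Finset.le_sup (f := fun x => Nat.choose x k * Nat.choose (n - x) l)
    (Finset.mem_range.2 (by omega))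

lemma exists_pVal_eq (n k l : ℕ) :
    ∃ x y, x + y = n ∧ pVal n k l = x.choose k * y.choose l := by
  obtain ⟨x, hx, h⟩ := Finset.exists_mem_eq_sup (Finset.range (n + 1)) ⟨0, by simp⟩
    (fun x => Nat.choose x k * Nat.choose (n - x) l)
  exact ⟨x, n - x, by have := Finset.mem_range.1 hx; omega, h⟩

lemma pVal_comm_le (n k l : ℕ) : pVal n k l ≤ pVal n l k := by
  obtain ⟨x, y, h, e⟩ := exists_pVal_eq n k l
  rw [e, mul_comm]
  exact choose_mul_choose_le_pVal l k (by omega)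

lemma pVal_comm (n k l : ℕ) : pVal n k l = pVal n l k :=
  le_antisymm (pVal_comm_le n k l) (pVal_comm_le n l k)

lemma pVal_zero_left (n l : ℕ) : pVal n 0 l = n.choose l := by
  apply le_antisymm
  · obtain ⟨x, y, h, e⟩ := exists_pVal_eq n 0 l
    rw [e, Nat.choose_zero_right, one_mul]
    exact Nat.choose_le_choose l (by omega)
  · simpa using choose_mul_choose_le_pVal 0 l (zero_add n)

lemma pVal_mul_le_pVal_succ (n k l : ℕ) :
    (n + 2) * pVal n k l ≤ (n + 2 - (k + l)) * pVal (n + 1) k l := by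
  obtain ⟨x, y, h, e⟩ := exists_pVal_eq n k l
  rw [e]
  rcases Nat.lt_or_ge x k with hx | hx
  · simp [Nat.choose_eq_zero_of_lt hx]
  rcases Nat.lt_or_ge y l with hy | hy
  · simp [Nat.choose_eq_zero_of_lt hy]
  have h1 := choose_mul_choose_le_pVal k l (show (x + 1) + y = n + 1 by omega)
  have h2 := choose_mul_choose_le_pVal k l (show x + (y + 1) = n + 1 by omega)
  have e1 := Nat.choose_mul_succ_eq x k
  have e2 := Nat.choose_mul_succ_eq y l
  calc (n + 2) * (x.choose k * y.choose l)
      = (x.choose k * (x + 1)) * y.choose l + x.choose k * (y.choose l * (y + 1)) := by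
        rw [← h]; ring
    _ = (x + 1 - k) * ((x + 1).choose k * y.choose l)
        + (y + 1 - l) * (x.choose k * (y + 1).choose l) := by rw [e1, e2]; ring
    _ ≤ (x + 1 - k) * pVal (n + 1) k l + (y + 1 - l) * pVal (n + 1) k l := by gcongr
    _ = (n + 2 - (k + l)) * pVal (n + 1) k l := by
        rw [← add_mul]; congr 1; omega

lemma pVal_mul_add_le {k l : ℕ} (hs : 2 ≤ k + l) (a m : ℕ) :
    pVal a k l * (a + m) ≤ a * pVal (a + m) k l := by
  rcases Nat.eq_zero_or_pos a with rfl | ha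
  · obtain ⟨x, y, h, e⟩ := exists_pVal_eq 0 k l
    obtain ⟨rfl, rfl⟩ : x = 0 ∧ y = 0 := by omega
    rcases Nat.eq_zero_or_pos k with rfl | hk
    · rw [e, Nat.choose_eq_zero_of_lt (show 0 < l by omega)]; simp
    · rw [e, Nat.choose_eq_zero_of_lt hk]; simp
  induction m with
  | zero => rw [mul_comm]; rfl
  | succ m ih =>
    have h1 := pVal_mul_le_pVal_succ (a + m) k l
    have h2 : (a + m + 2 - (k + l)) * pVal (a + m + 1) k l ≤ (a + m) * pVal (a + m + 1) k l :=
      Nat.mul_le_mul_right _ (by omega)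
    have hb : 0 < a + m := by omega
    rw [← add_assoc]
    generalize a + m = b at *
    apply Nat.le_of_mul_le_mul_left _ hb
    nlinarith [Nat.mul_le_mul_left a (h1.trans h2)]

lemma pVal_le_pVal_succ_succ {k : ℕ} (l n : ℕ) (hk : 1 ≤ k) :
    (n + 1) * pVal n k l ≤ 2 * (k + l) * pVal (n + 1) (k + 1) l := by
  obtain ⟨x, y, h, e⟩ := exists_pVal_eq n k l
  rcases Nat.lt_or_ge x k with hx | hx
  · simp [e, Nat.choose_eq_zero_of_lt hx]
  rcases Nat.lt_or_ge y l with hy | hy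
  · simp [e, Nat.choose_eq_zero_of_lt hy]
  have key : k * y ≤ l * (x + 1) := by
    rcases y with _ | y
    · simp
    have h1 := choose_mul_choose_le_pVal k l (show (x + 1) + y = n by omega)
    rw [e] at h1
    have e1 := Nat.choose_mul_succ_eq x k
    have e2 := Nat.choose_mul_succ_eq y l
    have hp : 0 < x.choose k * (y + 1).choose l :=
      Nat.mul_pos (Nat.choose_pos hx) (Nat.choose_pos hy)
    have h3 : (x.choose k * (y + 1).choose l) * ((x + 1) * (y + 1 - l)) ≤
        (x.choose k * (y + 1).choose l) * ((x + 1 - k) * (y + 1)) := by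
      calc _ = (x.choose k * (x + 1)) * ((y + 1).choose l * (y + 1 - l)) := by ring
        _ = ((x + 1).choose k * y.choose l) * ((x + 1 - k) * (y + 1)) := by
          rw [e1, ← e2]; ring
        _ ≤ _ := by gcongr
    have h4 := Nat.le_of_mul_le_mul_left h3 hp
    zify [show l ≤ y + 1 by omega, show k ≤ x + 1 by omega] at h4 ⊢
    nlinarith
  have h1 := choose_mul_choose_le_pVal (k + 1) l (show (x + 1) + y = n + 1 by omega)
  have e1 := Nat.add_one_mul_choose_eq x k
  rw [e]
  apply Nat.le_of_mul_le_mul_left _ hk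
  calc k * ((n + 1) * (x.choose k * y.choose l))
      = (k * (x + 1) + k * y) * (x.choose k * y.choose l) := by rw [← h]; ring
    _ ≤ (k * (x + 1) + l * (x + 1)) * (x.choose k * y.choose l) := by gcongr
    _ = (k + l) * (k + 1) * ((x + 1).choose (k + 1) * y.choose l) := by
      rw [mul_assoc (k + l), ← mul_assoc (k + 1), mul_comm (k + 1), ← e1]; ring
    _ ≤ (k + l) * (k + k) * pVal (n + 1) (k + 1) l := by gcongr
    _ = _ := by ring

lemma choose_le_choose_sub_add {N t : ℕ} (l : ℕ) (h : t ≤ N) :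
    (N + 1).choose (l + 1) ≤ (N + 1 - t).choose (l + 1) + t * N.choose l := by
  induction t with
  | zero => simp
  | succ t ih =>
    have h1 := ih (by omega)
    obtain ⟨a, rfl⟩ : ∃ a, N = a + t := ⟨N - t, by omega⟩
    rw [show a + t + 1 - t = a + 1 by omega, Nat.choose_succ_succ a] at h1
    have h2 : a.choose l ≤ (a + t).choose l := Nat.choose_le_choose l (by omega)
    rw [show a + t + 1 - (t + 1) = a by omega]
    linarith

lemma pVal_zero_left_le {l : ℕ} (n : ℕ) (hl : 1 ≤ l) :
    (n + 1) * pVal n 0 l ≤ 4 * l * pVal (n + 1) 1 l := by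
  rw [pVal_zero_left]
  rcases n with _ | N
  · simp [Nat.choose_eq_zero_of_lt (show 0 < l by omega)]
  obtain ⟨l, rfl⟩ : ∃ a, l = a + 1 := ⟨l - 1, by omega⟩
  set t := (N + 1) / (2 * (l + 1)) with ht
  have hdm := Nat.div_add_mod (N + 1) (2 * (l + 1))
  have hml := Nat.mod_lt (N + 1) (show 0 < 2 * (l + 1) by omega)
  rw [← ht] at hdm
  set r := (N + 1) % (2 * (l + 1))
  have htN : t ≤ N := by
    have : 2 * t ≤ 2 * (l + 1) * t := by nlinarith
    omega
  have h1 := choose_le_choose_sub_add l htN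
  have h2 := choose_mul_choose_le_pVal 1 (l + 1)
    (show (t + 1) + (N + 1 - t) = N + 1 + 1 by omega)
  rw [Nat.choose_one_right] at h2
  have e1 := Nat.add_one_mul_choose_eq N l
  generalize (N + 1).choose (l + 1) = c at *
  generalize N.choose l = d at *
  generalize (N + 1 - t).choose (l + 1) = f at *
  apply Nat.le_of_mul_le_mul_left _ (Nat.succ_pos N)
  have h3 : (N + 1) * c ≤ (N + 1) * f + t * (c * (l + 1)) := by
    calc _ ≤ (N + 1) * (f + t * d) := by gcongr
      _ = _ := by rw [← e1]; ring
  have h4 : ((N + 1) * (N + 1 + 1)) ≤ 4 * (l + 1) * (t + 1) * ((N + 1) - t * (l + 1)) := by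
    have : t * (l + 1) ≤ N + 1 := by nlinarith
    zify [this]
    zify at hdm hml
    rw [← hdm]
    have hr : (0 : ℤ) ≤ r := by positivity
    have ht0 : (0 : ℤ) ≤ t := by positivity
    have hl0 : (0 : ℤ) ≤ l := by positivity
    have : 0 ≤ (r : ℤ) * (2 * (l + 1) - 1 - r) := mul_nonneg hr (by linarith)
    nlinarith [mul_nonneg ht0 hl0, mul_nonneg (mul_nonneg ht0 hl0) hl0, mul_nonneg hr hl0]
  have h5 : ((N + 1) - t * (l + 1)) * c ≤ (N + 1) * f := by
    rw [Nat.sub_mul]; apply Nat.sub_le_of_le_add; linarith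
  calc (N + 1) * ((N + 1 + 1) * c) = ((N + 1) * (N + 1 + 1)) * c := by ring
    _ ≤ 4 * (l + 1) * (t + 1) * ((N + 1) - t * (l + 1)) * c := by gcongr
    _ = 4 * (l + 1) * (t + 1) * (((N + 1) - t * (l + 1)) * c) := by ring
    _ ≤ 4 * (l + 1) * (t + 1) * ((N + 1) * f) := by gcongr
    _ = (N + 1) * (4 * (l + 1) * ((t + 1) * f)) := by ring
    _ ≤ _ := by gcongr

lemma pVal_add_two_left {l : ℕ} (n k : ℕ) (hl : 1 ≤ l) :
    (n + 2) * (n + 1) * pVal n k l ≤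
      8 * (k + l + 1) * (k + l) * pVal (n + 2) (k + 2) l := by
  have h1 := pVal_le_pVal_succ_succ l (n + 1) (show 1 ≤ k + 1 by omega)
  have h2 : (n + 1) * pVal n k l ≤ 4 * (k + l) * pVal (n + 1) (k + 1) l := by
    rcases Nat.eq_zero_or_pos k with rfl | hk
    · simpa using pVal_zero_left_le n hl
    · exact (pVal_le_pVal_succ_succ l n hk).trans (by gcongr; norm_num)
  calc (n + 2) * (n + 1) * pVal n k l = (n + 2) * ((n + 1) * pVal n k l) := by ring
    _ ≤ (n + 2) * (4 * (k + l) * pVal (n + 1) (k + 1) l) := by gcongr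
    _ = 4 * (k + l) * ((n + 1 + 1) * pVal (n + 1) (k + 1) l) := by ring
    _ ≤ 4 * (k + l) * (2 * (k + 1 + l) * pVal (n + 2) (k + 2) l) := by gcongr
    _ = _ := by ring

lemma pVal_succ_succ {k : ℕ} (n l : ℕ) (hk : 1 ≤ k) :
    (n + 2) * (n + 1) * pVal n k l ≤
      8 * (k + l + 1) * (k + l) * pVal (n + 2) (k + 1) (l + 1) := by
  have h1 := pVal_le_pVal_succ_succ (l + 1) (n + 1) hk
  have h2 : (n + 1) * pVal n k l ≤ 4 * (k + l) * pVal (n + 1) k (l + 1) := by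
    rw [pVal_comm n k, pVal_comm _ k]
    rcases Nat.eq_zero_or_pos l with rfl | hl
    · simpa using pVal_zero_left_le n hk
    · exact (pVal_le_pVal_succ_succ k n hl).trans (by rw [add_comm l k]; gcongr; norm_num)
  calc (n + 2) * (n + 1) * pVal n k l = (n + 2) * ((n + 1) * pVal n k l) := by ring
    _ ≤ (n + 2) * (4 * (k + l) * pVal (n + 1) k (l + 1)) := by gcongr
    _ = 4 * (k + l) * ((n + 1 + 1) * pVal (n + 1) k (l + 1)) := by ring
    _ ≤ 4 * (k + l) * (2 * (k + (l + 1)) * pVal (n + 2) (k + 1) (l + 1)) := by gcongr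
    _ = _ := by ring

lemma choose_mul_choose_le_two_pow_mul_pVal (n k l : ℕ) :
    n.choose (k + l) * (k + l).choose k ≤ 2 ^ (k + l) * pVal n k l := by
  rcases Nat.lt_or_ge n (k + l) with hn | hn
  · simp [Nat.choose_eq_zero_of_lt hn]
  obtain ⟨d, rfl⟩ : ∃ d, n = k + l + d := ⟨n - (k + l), by omega⟩
  have term : ∀ i ∈ Finset.range (d + 1),
      (k + l + d).choose (k + l) * (k + l).choose k * d.choose i ≤
        (k + l + d).choose (k + i) * pVal (k + l + d) k l := by
    intro i hi
    have hi : i ≤ d := by simpa [Nat.lt_succ_iff] using hi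
    obtain ⟨j, rfl⟩ : ∃ j, d = i + j := ⟨d - i, by omega⟩
    refine le_trans (le_of_eq ?_) (Nat.mul_le_mul_left _ (choose_mul_choose_le_pVal k l
      (show (k + i) + (l + j) = k + l + (i + j) by omega)))
    have hc : ∀ a b : ℕ, (a + b).choose a * (a.factorial * b.factorial) = (a + b).factorial := by
      intro a b
      rw [← mul_assoc, Nat.choose_symm_add]
      exact Nat.add_choose_mul_factorial_mul_factorial a b
    have e1 := hc (k + l) (i + j)
    have e2 := hc k l
    have e3 := hc i j
    have e4 := hc (k + i) (l + j)
    have e5 := hc k i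
    have e6 := hc l j
    rw [show k + i + (l + j) = k + l + (i + j) by ring] at e4
    have hp : 0 < k.factorial * l.factorial * (i.factorial * j.factorial) := by positivity
    apply Nat.eq_of_mul_eq_mul_right hp
    calc _ = (k + l + (i + j)).choose (k + l) *
          (((k + l).choose k * (k.factorial * l.factorial)) *
          ((i + j).choose i * (i.factorial * j.factorial))) := by ring
      _ = (k + l + (i + j)).choose (k + i) *
          (((k + i).choose k * (k.factorial * i.factorial)) *
          ((l + j).choose l * (l.factorial * j.factorial))) := by rw [e2, e3, e1, e5, e6, e4]
      _ = _ := by ring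
  have h1 := Finset.sum_le_sum term
  rw [← Finset.mul_sum, Nat.sum_range_choose, ← Finset.sum_mul] at h1
  have h2 : ∑ i ∈ Finset.range (d + 1), (k + l + d).choose (k + i) ≤ 2 ^ (k + l + d) := by
    rw [← Nat.sum_range_choose (k + l + d),
      ← Finset.sum_image (g := fun i => k + i) (f := fun x => (k + l + d).choose x)
        (by intro a _ b _ h; simpa using h)]
    apply Finset.sum_le_sum_of_subset
    intro x hx
    simp only [Finset.mem_image, Finset.mem_range] at hx ⊢
    omega
  have h3 := h1.trans (Nat.mul_le_mul_right (pVal (k + l + d) k l) h2)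
  apply Nat.le_of_mul_le_mul_right _ (show 0 < 2 ^ d by positivity)
  calc _ ≤ _ := h3
    _ = _ := by rw [pow_add]; ring

/-- The support of a signed set, given as the pair of its positive and negative parts. -/
def signedSupp {α : Type*} [DecidableEq α] (v : Finset α × Finset α) : Finset α := v.1 ∪ v.2

/-- `v` is a signed set on the ground set `S` with `k` positive and `l` negative elements. -/
def IsSigned {α : Type*} (S : Finset α) (k l : ℕ) (v : Finset α × Finset α) : Prop :=
  v.1 ⊆ S ∧ v.2 ⊆ S ∧ Disjoint v.1 v.2 ∧ v.1.card = k ∧ v.2.card = l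

/-- Whenever two members have opposite signs at some element, they have equal signs at another. -/
def ConflictCompensated {α : Type*} (F : Finset (Finset α × Finset α)) : Prop :=
  ∀ v ∈ F, ∀ w ∈ F, ∀ i ∈ v.1, i ∈ w.2 → ∃ j, (j ∈ v.1 ∧ j ∈ w.1) ∨ (j ∈ v.2 ∧ j ∈ w.2)

section Counting

variable {α : Type*} [DecidableEq α] {S : Finset α} {k l : ℕ}

lemma IsSigned.card_signedSupp {v : Finset α × Finset α} (h : IsSigned S k l v) :
    (signedSupp v).card = k + l := by
  obtain ⟨-, -, hd, rfl, rfl⟩ := h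
  exact Finset.card_union_of_disjoint hd

lemma IsSigned.signedSupp_subset {v : Finset α × Finset α} (h : IsSigned S k l v) :
    signedSupp v ⊆ S := Finset.union_subset h.1 h.2.1

lemma card_le_of_subset_signedSupp {F : Finset (Finset α × Finset α)} {Z : Finset α}
    (hF : ∀ v ∈ F, IsSigned S k l v) (hZ : ∀ v ∈ F, Z ⊆ signedSupp v) :
    F.card ≤ (k + l).choose k * (S.card - Z.card).choose (k + l - Z.card) := by
  rcases F.eq_empty_or_nonempty with rfl | ⟨v₀, hv₀⟩
  · simp
  have hZS : Z ⊆ S := (hZ v₀ hv₀).trans (hF v₀ hv₀).signedSupp_subset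
  have h1 : (F.image signedSupp).card ≤ (S.card - Z.card).choose (k + l - Z.card) := by
    rw [← Finset.card_sdiff_of_subset hZS, ← Finset.card_powersetCard]
    apply Finset.card_le_card_of_injOn (fun U => U \ Z)
    · intro U hU
      obtain ⟨v, hv, rfl⟩ := Finset.mem_image.1 (Finset.mem_coe.1 hU)
      rw [Finset.mem_coe, Finset.mem_powersetCard]
      exact ⟨Finset.sdiff_subset_sdiff (hF v hv).signedSupp_subset subset_rfl, by
        rw [Finset.card_sdiff_of_subset (hZ v hv), (hF v hv).card_signedSupp]⟩
    · intro U hU U' hU' h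
      obtain ⟨v, hv, rfl⟩ := Finset.mem_image.1 (Finset.mem_coe.1 hU)
      obtain ⟨w, hw, rfl⟩ := Finset.mem_image.1 (Finset.mem_coe.1 hU')
      rw [← Finset.sdiff_union_of_subset (hZ v hv), ← Finset.sdiff_union_of_subset (hZ w hw)]
      simp only at h
      rw [h]
  refine (Finset.card_le_mul_card_image (f := signedSupp) F ((k + l).choose k) ?_).trans
    (Nat.mul_le_mul_left _ h1)
  intro U hU
  obtain ⟨u, hu, rfl⟩ := Finset.mem_image.1 hU
  rw [← (hF u hu).card_signedSupp, ← Finset.card_powersetCard]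
  apply Finset.card_le_card_of_injOn Prod.fst
  · intro v hv
    obtain ⟨hv, he⟩ := Finset.mem_filter.1 (Finset.mem_coe.1 hv)
    rw [Finset.mem_coe, Finset.mem_powersetCard, ← he]
    exact ⟨Finset.subset_union_left, (hF v hv).2.2.2.1⟩
  · intro v hv w hw h
    obtain ⟨hv, he⟩ := Finset.mem_filter.1 (Finset.mem_coe.1 hv)
    obtain ⟨hw, he'⟩ := Finset.mem_filter.1 (Finset.mem_coe.1 hw)
    refine Prod.ext h ?_
    rw [← Finset.union_sdiff_cancel_left (hF v hv).2.2.1,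
      ← Finset.union_sdiff_cancel_left (hF w hw).2.2.1, ← h]
    have : v.1 ∪ v.2 = w.1 ∪ w.2 := he.trans he'.symm
    rw [this, h]

lemma card_le_of_between {F : Finset (Finset α × Finset α)} {X Y I J : Finset α}
    (hF : ∀ v ∈ F, IsSigned S k l v) (hX : ∀ v ∈ F, v.1 ⊆ X ∧ v.2 ⊆ Y)
    (hI : ∀ v ∈ F, I ⊆ v.1 ∧ J ⊆ v.2) :
    F.card ≤ (X \ I).card.choose (k - I.card) * (Y \ J).card.choose (l - J.card) := by
  rw [← Finset.card_powersetCard, ← Finset.card_powersetCard, ← Finset.card_product]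
  apply Finset.card_le_card_of_injOn (fun v => (v.1 \ I, v.2 \ J))
  · intro v hv
    have hv := Finset.mem_coe.1 hv
    simp only [Finset.coe_product, Set.mem_prod, Finset.mem_coe, Finset.mem_powersetCard]
    refine ⟨⟨Finset.sdiff_subset_sdiff (hX v hv).1 subset_rfl, ?_⟩,
      Finset.sdiff_subset_sdiff (hX v hv).2 subset_rfl, ?_⟩
    · rw [Finset.card_sdiff_of_subset (hI v hv).1, (hF v hv).2.2.2.1]
    · rw [Finset.card_sdiff_of_subset (hI v hv).2, (hF v hv).2.2.2.2]
  · intro v hv w hw h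
    have hv := Finset.mem_coe.1 hv
    have hw := Finset.mem_coe.1 hw
    obtain ⟨h1, h2⟩ := Prod.mk.inj h
    refine Prod.ext ?_ ?_
    · rw [← Finset.sdiff_union_of_subset (hI v hv).1, ← Finset.sdiff_union_of_subset (hI w hw).1,
        h1]
    · rw [← Finset.sdiff_union_of_subset (hI v hv).2, ← Finset.sdiff_union_of_subset (hI w hw).2,
        h2]

/-- If all members contain `i` and `j` and meet a fixed signed support avoiding `j` outside `i`,
there are few of them. -/
lemma card_le_of_forall_mem_of_inter {F : Finset (Finset α × Finset α)} {i j : α} {U : Finset α}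
    (hF : ∀ v ∈ F, IsSigned S k l v) (hij : j ≠ i)
    (hi : ∀ v ∈ F, i ∈ signedSupp v) (hj : ∀ v ∈ F, j ∈ signedSupp v)
    (hU : U.card = k + l) (hiU : i ∈ U) (hjU : j ∉ U)
    (hmeet : ∀ v ∈ F, ∃ a, a ≠ i ∧ a ∈ signedSupp v ∧ a ∈ U) :
    F.card ≤ (k + l - 1) * ((k + l).choose k * (S.card - 3).choose (k + l - 3)) := by
  rw [← hU, ← Finset.card_erase_of_mem hiU, hU]
  have hsub : F ⊆ (U.erase i).biUnion fun a => F.filter fun v => a ∈ signedSupp v := by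
    intro v hv
    obtain ⟨a, ha, hav, haU⟩ := hmeet v hv
    exact Finset.mem_biUnion.2 ⟨a, Finset.mem_erase.2 ⟨ha, haU⟩, Finset.mem_filter.2 ⟨hv, hav⟩⟩
  refine (Finset.card_le_card hsub).trans (Finset.card_biUnion_le_card_mul _ _ _ fun a ha => ?_)
  obtain ⟨hai, haU⟩ := Finset.mem_erase.1 ha
  have hc : ({i, j, a} : Finset α).card = 3 :=
    Finset.card_eq_three.2 ⟨i, j, a, hij.symm, hai.symm, fun h => hjU (h ▸ haU), rfl⟩
  rw [← hc]
  apply card_le_of_subset_signedSupp (fun v hv => hF v (Finset.mem_filter.1 hv).1)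
  intro v hv
  obtain ⟨hv, hav⟩ := Finset.mem_filter.1 hv
  simp only [Finset.insert_subset_iff, Finset.singleton_subset_iff]
  exact ⟨hi v hv, hj v hv, hav⟩

/-- Two families through `i` that cross-intersect outside `i`: either they share a second common
element, or one of them is small. -/
lemma exists_common_or_card_le {P Q : Finset (Finset α × Finset α)} {i : α}
    (hP : ∀ v ∈ P, IsSigned S k l v) (hQ : ∀ v ∈ Q, IsSigned S k l v)
    (hPi : ∀ v ∈ P, i ∈ signedSupp v) (hQi : ∀ v ∈ Q, i ∈ signedSupp v)
    (hQne : Q.Nonempty)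
    (hmeet : ∀ v ∈ P, ∀ w ∈ Q, ∃ a, a ≠ i ∧ a ∈ signedSupp v ∧ a ∈ signedSupp w) :
    (∃ j, j ≠ i ∧ (∀ v ∈ P, j ∈ signedSupp v) ∧ ∀ v ∈ Q, j ∈ signedSupp v) ∨
    P.card ≤ (k + l - 1) ^ 2 * ((k + l).choose k * (S.card - 3).choose (k + l - 3)) ∨
    Q.card ≤ (k + l - 1) ^ 2 * ((k + l).choose k * (S.card - 3).choose (k + l - 3)) := by
  by_cases hcase : ∃ j, j ≠ i ∧ ∀ w ∈ Q, j ∈ signedSupp w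
  · obtain ⟨j, hji, hj⟩ := hcase
    by_cases hPj : ∀ v ∈ P, j ∈ signedSupp v
    · exact Or.inl ⟨j, hji, hPj, hj⟩
    push Not at hPj
    obtain ⟨u, hu, hju⟩ := hPj
    refine Or.inr (Or.inr ((card_le_of_forall_mem_of_inter hQ hji hQi hj (hP u hu).card_signedSupp
      (hPi u hu) hju fun w hw => ?_).trans (Nat.mul_le_mul_right _ ?_)))
    · obtain ⟨a, h1, h2, h3⟩ := hmeet u hu w hw
      exact ⟨a, h1, h3, h2⟩
    · exact Nat.le_self_pow two_ne_zero _
  · push Not at hcase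
    right; left
    obtain ⟨w₀, hw₀⟩ := hQne
    have hsub : P ⊆ ((signedSupp w₀).erase i).biUnion
        fun a => P.filter fun v => a ∈ signedSupp v := by
      intro v hv
      obtain ⟨a, ha, hav, haU⟩ := hmeet v hv w₀ hw₀
      exact Finset.mem_biUnion.2 ⟨a, Finset.mem_erase.2 ⟨ha, haU⟩, Finset.mem_filter.2 ⟨hv, hav⟩⟩
    rw [sq, mul_assoc]
    nth_rw 1 [← (hQ w₀ hw₀).card_signedSupp]
    rw [← Finset.card_erase_of_mem (hQi w₀ hw₀)]
    refine (Finset.card_le_card hsub).trans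
      (Finset.card_biUnion_le_card_mul _ _ _ fun a ha => ?_)
    obtain ⟨u, hu, hau⟩ := hcase a (Finset.mem_erase.1 ha).1
    refine card_le_of_forall_mem_of_inter (fun v hv => hP v (Finset.mem_filter.1 hv).1)
      (Finset.mem_erase.1 ha).1 (fun v hv => hPi v (Finset.mem_filter.1 hv).1)
      (fun v hv => (Finset.mem_filter.1 hv).2) (hQ u hu).card_signedSupp (hQi u hu) hau
      fun v hv => hmeet v (Finset.mem_filter.1 hv).1 u hu

/-- The signed sets compatible with a fixed sign pattern that contain two given elements. -/
lemma card_pattern_pair_le {F : Finset (Finset α × Finset α)} {X Y : Finset α} {i j : α}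
    (hk : 2 ≤ k) (hl : 1 ≤ l) (hF : ∀ v ∈ F, IsSigned S k l v) (hXY : Disjoint X Y)
    (hpat : ∀ v ∈ F, v.1 ⊆ X ∧ v.2 ⊆ Y) (hij : j ≠ i)
    (hi : ∀ v ∈ F, i ∈ signedSupp v) (hj : ∀ v ∈ F, j ∈ signedSupp v) :
    (X.card + Y.card) * (X.card + Y.card - 1) * F.card ≤
      8 * (k + l - 1) * (k + l - 2) * pVal (X.card + Y.card) k l := by
  rcases F.eq_empty_or_nonempty with rfl | ⟨v₀, hv₀⟩
  · simp
  have hmem : ∀ a, ∀ v ∈ F, a ∈ signedSupp v → (a ∈ X → a ∈ v.1) ∧ (a ∈ Y → a ∈ v.2) := by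
    intro a v hv ha
    rcases Finset.mem_union.1 ha with h | h
    · exact ⟨fun _ => h, fun hY => (Finset.disjoint_left.1 hXY ((hpat v hv).1 h) hY).elim⟩
    · exact ⟨fun hX => (Finset.disjoint_left.1 hXY hX ((hpat v hv).2 h)).elim, fun _ => h⟩
  have hcase : ∀ a, a ∈ signedSupp v₀ → a ∈ X ∨ a ∈ Y := fun a ha =>
    (Finset.mem_union.1 ha).imp (fun h => (hpat v₀ hv₀).1 h) (fun h => (hpat v₀ hv₀).2 h)
  have hcards : (X.card + Y.card - 2) + 2 = X.card + Y.card := by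
    have : ({i, j} : Finset α) ⊆ X ∪ Y := by
      simp only [Finset.insert_subset_iff, Finset.singleton_subset_iff, Finset.mem_union]
      exact ⟨hcase i (hi v₀ hv₀), hcase j (hj v₀ hv₀)⟩
    have := Finset.card_le_card this
    rw [Finset.card_pair hij.symm, Finset.card_union_of_disjoint hXY] at this
    omega
  obtain ⟨m, hm⟩ : ∃ m, X.card + Y.card = m + 2 := ⟨_, hcards.symm⟩
  have main : ∀ I J : Finset α, I ⊆ X → J ⊆ Y → I.card + J.card = 2 →
      (∀ v ∈ F, I ⊆ v.1 ∧ J ⊆ v.2) → F.card ≤ pVal m (k - I.card) (l - J.card) := by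
    intro I J hIX hJY hc h
    refine (card_le_of_between hF hpat h).trans (choose_mul_choose_le_pVal _ _ ?_)
    rw [Finset.card_sdiff_of_subset hIX, Finset.card_sdiff_of_subset hJY]
    have := Finset.card_le_card hIX
    have := Finset.card_le_card hJY
    omega
  have hone : ∀ a b, a ∈ X → b ∈ Y → (∀ v ∈ F, a ∈ signedSupp v) → (∀ v ∈ F, b ∈ signedSupp v) →
      F.card ≤ pVal m (k - 1) (l - 1) := by
    intro a b ha hb hav hbv
    simpa using main {a} {b} (by simpa) (by simpa) (by simp) fun v hv => by
      simpa using ⟨(hmem a v hv (hav v hv)).1 ha, (hmem b v hv (hbv v hv)).2 hb⟩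
  have hpm : F.card ≤ pVal m (k - 1) (l - 1) → (m + 2) * (m + 1) * F.card ≤
      8 * (k + l - 1) * (k + l - 2) * pVal (m + 2) k l := by
    intro h
    obtain ⟨k, rfl⟩ : ∃ a, k = a + 1 := ⟨k - 1, by omega⟩
    obtain ⟨l, rfl⟩ : ∃ a, l = a + 1 := ⟨l - 1, by omega⟩
    have := pVal_succ_succ m l (show 1 ≤ k by omega)
    rw [show k + 1 + (l + 1) - 1 = k + l + 1 by omega, show k + 1 + (l + 1) - 2 = k + l by omega]
    exact (Nat.mul_le_mul_left _ h).trans this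
  rw [hm, show m + 2 - 1 = m + 1 by omega]
  rcases hcase i (hi v₀ hv₀) with hiX | hiY <;> rcases hcase j (hj v₀ hv₀) with hjX | hjY
  · have h := main {i, j} ∅ (by simp [Finset.insert_subset_iff, hiX, hjX]) (by simp)
      (by simp [Finset.card_pair hij.symm]) fun v hv => by
        simpa [Finset.insert_subset_iff] using
          ⟨(hmem i v hv (hi v hv)).1 hiX, (hmem j v hv (hj v hv)).1 hjX⟩
    rw [Finset.card_pair hij.symm, Finset.card_empty, Nat.sub_zero] at h
    obtain ⟨k, rfl⟩ : ∃ a, k = a + 2 := ⟨k - 2, by omega⟩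
    have := pVal_add_two_left m k hl
    rw [show k + 2 + l - 1 = k + l + 1 by omega, show k + 2 + l - 2 = k + l by omega]
    exact (Nat.mul_le_mul_left _ h).trans this
  · exact hpm (hone i j hiX hjY hi hj)
  · exact hpm (hone j i hjX hiY hj hi)
  · have hsub : ∀ v ∈ F, {i, j} ⊆ v.2 := fun v hv => by
      simpa [Finset.insert_subset_iff] using
          ⟨(hmem i v hv (hi v hv)).2 hiY, (hmem j v hv (hj v hv)).2 hjY⟩
    have h := main ∅ {i, j} (by simp) (by simp [Finset.insert_subset_iff, hiY, hjY])
      (by simp [Finset.card_pair hij.symm]) fun v hv => ⟨by simp, hsub v hv⟩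
    have hl2 := Finset.card_le_card (hsub v₀ hv₀)
    rw [Finset.card_pair hij.symm, (hF v₀ hv₀).2.2.2.2] at hl2
    rw [Finset.card_pair hij.symm, Finset.card_empty, Nat.sub_zero, pVal_comm] at h
    obtain ⟨l, rfl⟩ : ∃ a, l = a + 2 := ⟨l - 2, by omega⟩
    have := pVal_add_two_left m l (show 1 ≤ k by omega)
    rw [show k + (l + 2) - 1 = l + k + 1 by omega, show k + (l + 2) - 2 = l + k by omega,
      pVal_comm _ k]
    exact (Nat.mul_le_mul_left _ h).trans this

end Counting

lemma three_mul_cubic_le (t : ℕ) : 3 * ((t + 2) ^ 2 * (t + 1)) ≤ (t + 3) * 2 ^ (t + 3) := by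
  rcases Nat.lt_or_ge t 3 with h | h
  · interval_cases t <;> norm_num
  induction t, h using Nat.le_induction with
  | base => norm_num
  | succ t ht ih =>
    obtain ⟨u, rfl⟩ : ∃ u, t = u + 3 := ⟨t - 3, by omega⟩
    have h2 : 3 * ((u + 3 + 1 + 2) ^ 2 * (u + 3 + 1 + 1)) ≤
        2 * (3 * ((u + 3 + 2) ^ 2 * (u + 3 + 1))) := by
      ring_nf
      nlinarith [Nat.zero_le (u ^ 3), Nat.zero_le (u ^ 2)]
    calc _ ≤ _ := h2
      _ ≤ 2 * ((u + 3 + 3) * 2 ^ (u + 3 + 3)) := by gcongr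
      _ = (u + 3 + 3) * 2 ^ (u + 3 + 1 + 3) := by ring
      _ ≤ _ := Nat.mul_le_mul_right _ (by omega)

lemma three_mul_quartic_le (t : ℕ) :
    3 * ((t + 2) ^ 3 * (t + 1)) ≤ 8 * ((t + 3) * 2 ^ (t + 3)) := by
  rcases Nat.lt_or_ge t 4 with h | h
  · interval_cases t <;> norm_num
  induction t, h using Nat.le_induction with
  | base => norm_num
  | succ t ht ih =>
    obtain ⟨u, rfl⟩ : ∃ u, t = u + 4 := ⟨t - 4, by omega⟩
    have h2 : 3 * ((u + 4 + 1 + 2) ^ 3 * (u + 4 + 1 + 1)) ≤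
        2 * (3 * ((u + 4 + 2) ^ 3 * (u + 4 + 1))) := by
      ring_nf
      nlinarith [Nat.zero_le (u ^ 3), Nat.zero_le (u ^ 2), Nat.zero_le (u ^ 4)]
    calc _ ≤ _ := h2
      _ ≤ 2 * (8 * ((u + 4 + 3) * 2 ^ (u + 4 + 3))) := by gcongr
      _ = 8 * ((u + 4 + 3) * 2 ^ (u + 4 + 1 + 3)) := by ring
      _ ≤ _ := Nat.mul_le_mul_left _ (Nat.mul_le_mul_right _ (by omega))

lemma choose_mul_descending (N t : ℕ) :
    (N + 2) * (N + 1) * N * (N - 1).choose t =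
      (t + 3) * (t + 2) * (t + 1) * (N + 2).choose (t + 3) := by
  rcases N with _ | N
  · rcases t with _ | t <;> simp [Nat.choose]
  have e1 := Nat.add_one_mul_choose_eq N t
  have e2 := Nat.add_one_mul_choose_eq (N + 1) (t + 1)
  have e3 := Nat.add_one_mul_choose_eq (N + 2) (t + 2)
  calc _ = (N + 1 + 2) * ((N + 1 + 1) * ((N + 1) * N.choose t)) := by
        rw [Nat.add_sub_cancel]; ring
    _ = (t + 1) * ((N + 2 + 1) * ((N + 1 + 1) * (N + 1).choose (t + 1))) := by rw [e1]; ring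
    _ = (t + 1) * (t + 2) * ((N + 2 + 1) * (N + 2).choose (t + 2)) := by
        rw [e2]; ring
    _ = _ := by rw [e3]; ring

lemma mul_add_le_pVal {k l n c : ℕ} (hkl : 3 ≤ k + l) (hn : (k + l) * 2 ^ (k + l + 2) < n)
    (hc : n * (n - 1) * c ≤ (k + l - 1) * (8 * (k + l - 1) * (k + l - 2) * pVal n k l)) :
    n * (c + (k + l - 1) ^ 2 * ((k + l).choose k * (n - 3).choose (k + l - 3))) ≤
      pVal n k l := by
  obtain ⟨t, ht⟩ : ∃ t, k + l = t + 3 := ⟨k + l - 3, by omega⟩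
  have hT := choose_mul_choose_le_two_pow_mul_pVal n k l
  rw [ht] at hn hc hT ⊢
  have hpow : 0 < 2 ^ (t + 3) := by positivity
  have hpe : (t + 3) * 2 ^ (t + 3 + 2) = 4 * ((t + 3) * 2 ^ (t + 3)) := by ring
  have hlow : 4 ≤ 4 * ((t + 3) * 2 ^ (t + 3)) := by nlinarith
  obtain ⟨N, rfl⟩ : ∃ N, n = N + 2 := ⟨n - 2, by omega⟩
  have hN : 4 * ((t + 3) * 2 ^ (t + 3)) ≤ N + 1 := by omega
  have hdesc := choose_mul_descending N t
  have c1 := three_mul_cubic_le t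
  have c2 := three_mul_quartic_le t
  rw [show t + 3 - 1 = t + 2 by omega, show t + 3 - 2 = t + 1 by omega,
    show N + 2 - 1 = N + 1 by omega] at hc
  rw [show t + 3 - 1 = t + 2 by omega, show t + 3 - 3 = t by omega,
    show N + 2 - 3 = N - 1 by omega]
  generalize pVal (N + 2) k l = p at *
  generalize (N - 1).choose t = d at *
  generalize (N + 2).choose (t + 3) = b at *
  generalize (t + 3).choose k = q at *
  generalize 2 ^ (t + 3) = u at *
  have A : 3 * ((N + 2) * c) ≤ 2 * p := by
    apply Nat.le_of_mul_le_mul_left _ (show 0 < N + 1 by omega)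
    calc (N + 1) * (3 * ((N + 2) * c)) = 3 * ((N + 2) * (N + 1) * c) := by ring
      _ ≤ 3 * ((t + 2) * (8 * (t + 2) * (t + 1) * p)) := by gcongr
      _ = 8 * (3 * ((t + 2) ^ 2 * (t + 1))) * p := by ring
      _ ≤ 8 * ((t + 3) * u) * p := by gcongr
      _ = 2 * (4 * ((t + 3) * u)) * p := by ring
      _ ≤ 2 * (N + 1) * p := by gcongr
      _ = _ := by ring
  have B : 3 * ((N + 2) * ((t + 2) ^ 2 * (q * d))) ≤ p := by
    have hpos : 0 < (N + 1) * N := Nat.mul_pos (by omega) (by omega)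
    apply Nat.le_of_mul_le_mul_left _ hpos
    calc (N + 1) * N * (3 * ((N + 2) * ((t + 2) ^ 2 * (q * d))))
        = 3 * (t + 2) ^ 2 * q * ((N + 2) * (N + 1) * N * d) := by ring
      _ = 3 * (t + 2) ^ 3 * (t + 1) * (t + 3) * (b * q) := by rw [hdesc]; ring
      _ ≤ 3 * (t + 2) ^ 3 * (t + 1) * (t + 3) * (u * p) := by gcongr
      _ = (3 * ((t + 2) ^ 3 * (t + 1))) * ((t + 3) * u) * p := by ring
      _ ≤ (8 * ((t + 3) * u)) * ((t + 3) * u) * p := by gcongr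
      _ = (4 * ((t + 3) * u)) * (2 * ((t + 3) * u)) * p := by ring
      _ ≤ (N + 1) * N * p := Nat.mul_le_mul_right _ (Nat.mul_le_mul hN (by omega))
  rw [mul_add]
  linarith

section Main

variable {α : Type*} [DecidableEq α] {S : Finset α} {k l : ℕ}

/-- If every element of mixed sign has few members with one of the two signs, the family is no
larger than the best one of constant sign pattern. -/
lemma card_le_pVal_of_minority {F : Finset (Finset α × Finset α)} {e : ℕ}
    (hk : 2 ≤ k) (hl : 1 ≤ l) (hF : ∀ v ∈ F, IsSigned S k l v) (hcc : ConflictCompensated F)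
    (hn : (k + l) * 2 ^ (k + l + 2) < S.card)
    (he : e = (k + l - 1) ^ 2 * ((k + l).choose k * (S.card - 3).choose (k + l - 3)))
    (hmin : ∀ i, (∃ v ∈ F, i ∈ v.1) → (∃ w ∈ F, i ∈ w.2) →
      (F.filter fun v => i ∈ v.1).card ≤ e ∨ (F.filter fun v => i ∈ v.2).card ≤ e) :
    F.card ≤ pVal S.card k l := by
  classical
  set M := S.filter fun i => (∃ v ∈ F, i ∈ v.1) ∧ ∃ w ∈ F, i ∈ w.2 with hM
  set X := S.filter fun i => (∃ v ∈ F, i ∈ v.1) ∧ (F.filter fun v => i ∈ v.2).card ≤ e with hX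
  set Y := S \ X with hY
  have hXS : X ⊆ S := Finset.filter_subset _ _
  have hMS : M ⊆ S := Finset.filter_subset _ _
  have hXY : Disjoint X Y := Finset.disjoint_sdiff
  have hcardXY : X.card + Y.card = S.card := by
    rw [hY, add_comm, Finset.card_sdiff_add_card_eq_card hXS]
  set F' := F.filter fun v => v.1 ⊆ X ∧ v.2 ⊆ Y with hF'
  have hF'F : F' ⊆ F := Finset.filter_subset _ _
  set W : α → Finset (Finset α × Finset α) := fun i =>
    (F'.filter fun v => i ∈ signedSupp v) ∪
      (if i ∈ X then F.filter fun v => i ∈ v.2 else F.filter fun v => i ∈ v.1) with hW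
  have hcover : F ⊆ (F'.filter fun v => ∀ i ∈ M, i ∉ signedSupp v) ∪ M.biUnion W := by
    intro v hv
    rw [Finset.mem_union, Finset.mem_biUnion]
    by_contra! hcon
    obtain ⟨h1, h2⟩ := hcon
    have hnb : ∀ i ∈ M, (i ∈ v.1 → i ∈ X) ∧ (i ∈ v.2 → i ∈ Y) := by
      intro i hi
      have h3 := h2 i hi
      simp only [hW, Finset.mem_union, not_or] at h3
      refine ⟨fun h => ?_, fun h => ?_⟩
      · by_contra hx
        rw [if_neg hx] at h3
        exact h3.2 (Finset.mem_filter.2 ⟨hv, h⟩)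
      · refine Finset.mem_sdiff.2 ⟨hMS hi, fun hx => ?_⟩
        rw [if_pos hx] at h3
        exact h3.2 (Finset.mem_filter.2 ⟨hv, h⟩)
    have hv' : v ∈ F' := by
      refine Finset.mem_filter.2 ⟨hv, fun i hi => ?_, fun i hi => ?_⟩
      · by_cases hiM : i ∈ M
        · exact (hnb i hiM).1 hi
        · have hiS := (hF v hv).1 hi
          refine Finset.mem_filter.2 ⟨hiS, ⟨v, hv, hi⟩, ?_⟩
          rw [Finset.filter_false_of_mem, Finset.card_empty]
          · exact Nat.zero_le _
          · intro w hw hiw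
            exact hiM (Finset.mem_filter.2 ⟨hiS, ⟨v, hv, hi⟩, ⟨w, hw, hiw⟩⟩)
      · by_cases hiM : i ∈ M
        · exact (hnb i hiM).2 hi
        · have hiS := (hF v hv).2.1 hi
          refine Finset.mem_sdiff.2 ⟨hiS, fun hx => ?_⟩
          exact hiM (Finset.mem_filter.2 ⟨hiS, (Finset.mem_filter.1 hx).2.1, ⟨v, hv, hi⟩⟩)
    refine h1 (Finset.mem_filter.2 ⟨hv', fun i hi his => h2 i hi ?_⟩)
    exact Finset.mem_union_left _ (Finset.mem_filter.2 ⟨hv', his⟩)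
  have hzero : (F'.filter fun v => ∀ i ∈ M, i ∉ signedSupp v).card ≤
      pVal (S.card - M.card) k l := by
    have h := card_le_of_between (F := F'.filter fun v => ∀ i ∈ M, i ∉ signedSupp v)
      (X := X \ M) (Y := Y \ M) (I := ∅) (J := ∅)
      (fun v hv => hF v (hF'F (Finset.mem_filter.1 hv).1))
      (fun v hv => by
        obtain ⟨hv, hvM⟩ := Finset.mem_filter.1 hv
        obtain ⟨-, h1, h2⟩ := Finset.mem_filter.1 hv
        exact ⟨fun i hi => Finset.mem_sdiff.2
            ⟨h1 hi, fun hiM => hvM i hiM (Finset.mem_union_left _ hi)⟩,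
          fun i hi => Finset.mem_sdiff.2
            ⟨h2 hi, fun hiM => hvM i hiM (Finset.mem_union_right _ hi)⟩⟩)
      (fun v _ => ⟨Finset.empty_subset _, Finset.empty_subset _⟩)
    simp only [Finset.sdiff_empty, Finset.card_empty, Nat.sub_zero] at h
    refine h.trans (choose_mul_choose_le_pVal k l ?_)
    rw [← Finset.card_union_of_disjoint (hXY.mono Finset.sdiff_subset Finset.sdiff_subset),
      ← Finset.union_sdiff_distrib, hY, Finset.union_sdiff_of_subset hXS,
      Finset.card_sdiff_of_subset hMS]
  have hwit : ∀ i ∈ M, ∃ w ∈ F, i ∈ signedSupp w ∧ ∀ v ∈ F', i ∈ signedSupp v →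
      ∃ j, j ≠ i ∧ j ∈ signedSupp v ∧ j ∈ signedSupp w := by
    intro i hi
    obtain ⟨hiS, ⟨u, hu, hiu⟩, ⟨w, hw, hiw⟩⟩ := Finset.mem_filter.1 hi
    have hdis : ∀ v ∈ F, ∀ a, a ∈ v.1 → a ∈ v.2 → False := fun v hv a h1 h2 =>
      Finset.disjoint_left.1 (hF v hv).2.2.1 h1 h2
    by_cases hx : i ∈ X
    · refine ⟨w, hw, Finset.mem_union_right _ hiw, fun v hv hiv => ?_⟩
      obtain ⟨hvF, hv1, hv2⟩ := Finset.mem_filter.1 hv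
      have hiv1 : i ∈ v.1 := (Finset.mem_union.1 hiv).resolve_right fun h =>
        Finset.disjoint_left.1 hXY hx (hv2 h)
      obtain ⟨j, ⟨h1, h2⟩ | ⟨h1, h2⟩⟩ := hcc v hvF w hw i hiv1 hiw
      · exact ⟨j, fun h => hdis w hw j h2 (h ▸ hiw), Finset.mem_union_left _ h1,
          Finset.mem_union_left _ h2⟩
      · exact ⟨j, fun h => hdis v hvF j (h ▸ hiv1) h1, Finset.mem_union_right _ h1,
          Finset.mem_union_right _ h2⟩
    · refine ⟨u, hu, Finset.mem_union_left _ hiu, fun v hv hiv => ?_⟩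
      obtain ⟨hvF, hv1, hv2⟩ := Finset.mem_filter.1 hv
      have hiv2 : i ∈ v.2 := (Finset.mem_union.1 hiv).resolve_left fun h => hx (hv1 h)
      obtain ⟨j, ⟨h1, h2⟩ | ⟨h1, h2⟩⟩ := hcc u hu v hvF i hiu hiv2
      · exact ⟨j, fun h => hdis v hvF j h2 (h ▸ hiv2), Finset.mem_union_left _ h2,
          Finset.mem_union_left _ h1⟩
      · exact ⟨j, fun h => hdis u hu j (h ▸ hiu) h1, Finset.mem_union_right _ h2,
          Finset.mem_union_right _ h1⟩
  have hmaj : ∀ i ∈ M, S.card * (S.card - 1) * (F'.filter fun v => i ∈ signedSupp v).card ≤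
      (k + l - 1) * (8 * (k + l - 1) * (k + l - 2) * pVal S.card k l) := by
    intro i hi
    obtain ⟨w, hw, hiw, hmeet⟩ := hwit i hi
    have hsub : (F'.filter fun v => i ∈ signedSupp v) ⊆ ((signedSupp w).erase i).biUnion
        fun j => F'.filter fun v => i ∈ signedSupp v ∧ j ∈ signedSupp v := by
      intro v hv
      obtain ⟨hv, hiv⟩ := Finset.mem_filter.1 hv
      obtain ⟨j, hji, hjv, hjw⟩ := hmeet v hv hiv
      exact Finset.mem_biUnion.2 ⟨j, Finset.mem_erase.2 ⟨hji, hjw⟩,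
        Finset.mem_filter.2 ⟨hv, hiv, hjv⟩⟩
    have hcard := (Finset.card_le_card hsub).trans Finset.card_biUnion_le
    refine (Nat.mul_le_mul_left _ hcard).trans ?_
    rw [Finset.mul_sum, ← (hF w hw).card_signedSupp, ← Finset.card_erase_of_mem hiw,
      Finset.card_erase_of_mem hiw, (hF w hw).card_signedSupp, ← smul_eq_mul (k + l - 1)]
    nth_rw 1 [← (hF w hw).card_signedSupp]
    rw [← Finset.card_erase_of_mem hiw]
    refine Finset.sum_le_card_nsmul _ _ _ fun j hj => ?_
    have := card_pattern_pair_le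
      (F := F'.filter fun v => i ∈ signedSupp v ∧ j ∈ signedSupp v) hk hl
      (fun v hv => hF v (hF'F (Finset.mem_filter.1 hv).1)) hXY
      (fun v hv => (Finset.mem_filter.1 (Finset.mem_filter.1 hv).1).2) (Finset.mem_erase.1 hj).1
      (fun v hv => (Finset.mem_filter.1 hv).2.1) (fun v hv => (Finset.mem_filter.1 hv).2.2)
    rwa [hcardXY] at this
  have hWi : ∀ i ∈ M, S.card * (W i).card ≤ pVal S.card k l := by
    intro i hi
    obtain ⟨hiS, hu, hw⟩ := Finset.mem_filter.1 hi
    have hbad : (if i ∈ X then F.filter fun v => i ∈ v.2 else F.filter fun v => i ∈ v.1).card ≤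
        e := by
      by_cases hx : i ∈ X
      · rw [if_pos hx]
        exact (Finset.mem_filter.1 hx).2.2
      · rw [if_neg hx]
        exact (hmin i hu hw).resolve_right fun h => hx (Finset.mem_filter.2 ⟨hiS, hu, h⟩)
    have := mul_add_le_pVal (by omega) hn (hmaj i hi)
    rw [← he] at this
    refine le_trans (Nat.mul_le_mul_left _ ?_) this
    exact (Finset.card_union_le _ _).trans (Nat.add_le_add_left hbad _)
  have hSpos : 0 < S.card := by omega
  have hsum : S.card * (M.biUnion W).card ≤ M.card * pVal S.card k l := by
    refine (Nat.mul_le_mul_left _ Finset.card_biUnion_le).trans ?_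
    rw [Finset.mul_sum, ← smul_eq_mul M.card]
    exact Finset.sum_le_card_nsmul _ _ _ hWi
  have hMle := Finset.card_le_card hMS
  have hmono := pVal_mul_add_le (show 2 ≤ k + l by omega) (S.card - M.card) M.card
  rw [Nat.sub_add_cancel hMle] at hmono
  apply Nat.le_of_mul_le_mul_left _ hSpos
  calc S.card * F.card
      ≤ S.card * (pVal (S.card - M.card) k l + (M.biUnion W).card) :=
        Nat.mul_le_mul_left _ ((Finset.card_le_card hcover).trans
          ((Finset.card_union_le _ _).trans (Nat.add_le_add_right hzero _)))
    _ = pVal (S.card - M.card) k l * S.card + S.card * (M.biUnion W).card := by ring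
    _ ≤ (S.card - M.card) * pVal S.card k l + M.card * pVal S.card k l := by gcongr
    _ = S.card * pVal S.card k l := by rw [← add_mul, Nat.sub_add_cancel hMle]

lemma two_mul_choose_add_pVal_le {n : ℕ} (hkl : 2 ≤ k + l)
    (hn : (k + l) * 2 ^ (k + l + 2) ≤ n) :
    2 * ((k + l).choose k * (n + 1 - 2).choose (k + l - 2)) + pVal n k l ≤
      pVal (n + 1) k l := by
  obtain ⟨t, ht⟩ : ∃ t, k + l = t + 2 := ⟨k + l - 2, by omega⟩
  have hT := choose_mul_choose_le_two_pow_mul_pVal n k l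
  have hD := pVal_mul_le_pVal_succ n k l
  rw [ht] at hn hT hD ⊢
  have hlow : t + 2 < 2 ^ (t + 2) := Nat.lt_two_pow_self
  have hpe : (t + 2) * 2 ^ (t + 2 + 2) = 4 * ((t + 2) * 2 ^ (t + 2)) := by ring
  have hbig : 2 ^ (t + 2) ≤ (t + 2) * 2 ^ (t + 2) := by nlinarith
  obtain ⟨m, rfl⟩ : ∃ m, n = m + t + 2 := ⟨n - t - 2, by omega⟩
  rw [show m + t + 2 + 2 - (t + 2) = m + 2 by omega] at hD
  rw [show m + t + 2 + 1 - 2 = m + t + 1 by omega, show t + 2 - 2 = t by omega]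
  have e2 := Nat.add_one_mul_choose_eq (m + t + 1) (t + 1)
  have e3 := Nat.choose_succ_right_eq (m + t + 1) t
  rw [show m + t + 1 - t = m + 1 by omega] at e3
  rw [show m + t + 2 = m + t + 1 + 1 by omega] at *
  generalize pVal (m + t + 1 + 1) k l = p at *
  generalize pVal (m + t + 1 + 1 + 1) k l = p' at *
  rw [show (m + t + 1 + 1).choose (t + 2) = (m + t + 1 + 1).choose (t + 1 + 1) from rfl] at hT
  generalize (m + t + 1 + 1).choose (t + 1 + 1) = b at *
  generalize (m + t + 1).choose (t + 1) = c at *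
  generalize (m + t + 1).choose t = d at *
  generalize (t + 2).choose k = q at *
  generalize 2 ^ (t + 2) = u at *
  have hN : 4 * ((t + 2) * u) ≤ m + t + 2 := by omega
  have key : 2 * (q * d) * (m + 2) ≤ (t + 2) * p := by
    have hupos : 0 < u := by omega
    apply Nat.le_of_mul_le_mul_left _ (show 0 < u * (t + 1) by positivity)
    calc u * (t + 1) * (2 * (q * d) * (m + 2))
        = (2 * (t + 1) * u * (m + 2)) * (q * d) := by ring
      _ ≤ (2 * (t + 2) * u * (2 * (m + 1))) * (q * d) := by gcongr <;> omega
      _ = 4 * ((t + 2) * u) * (m + 1) * (q * d) := by ring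
      _ ≤ ((m + t + 2) * (m + 1)) * (q * d) := by gcongr
      _ = q * ((m + t + 1 + 1) * (d * (m + 1))) := by ring
      _ = q * (((m + t + 1 + 1) * c) * (t + 1)) := by rw [← e3]; ring
      _ = (t + 2) * (t + 1) * (b * q) := by rw [e2]; ring
      _ ≤ (t + 2) * (t + 1) * (u * p) := by gcongr
      _ = _ := by ring
  apply Nat.le_of_mul_le_mul_left _ (show 0 < m + 2 by omega)
  calc _ = 2 * (q * d) * (m + 2) + (m + 2) * p := by ring
    _ ≤ (t + 2) * p + (m + 2) * p := by gcongr
    _ = (m + t + 1 + 1 + 2) * p := by ring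
    _ ≤ _ := hD

theorem two_mul_card_le {n : ℕ} (hl : 1 ≤ l) (hlk : l < k)
    (hn : (k + l) * 2 ^ (k + l + 2) ≤ n) :
    ∀ (S : Finset α) (F : Finset (Finset α × Finset α)), S.card = n →
      (∀ v ∈ F, IsSigned S k l v) → ConflictCompensated F →
      2 * F.card ≤ max (2 * pVal n k l)
        (2 * (Nat.choose ((k + l) * 2 ^ (k + l + 2)) k *
          Nat.choose ((k + l) * 2 ^ (k + l + 2)) l) + pVal n k l) := by
  induction n, hn using Nat.le_induction with
  | base =>
    intro S F hS hF _
    refine le_max_of_le_right (le_add_right (Nat.mul_le_mul_left 2 ?_))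
    have := card_le_of_between (X := S) (Y := S) (I := ∅) (J := ∅) hF
      (fun v hv => ⟨(hF v hv).1, (hF v hv).2.1⟩) (fun v _ => by simp)
    simpa [hS] using this
  | succ n hn ih =>
    intro S F hS hF hcc
    by_cases hdel : ∃ i ∈ S, (F.filter fun v => i ∈ signedSupp v).card ≤
        (k + l).choose k * (n + 1 - 2).choose (k + l - 2)
    · obtain ⟨i, hiS, hi⟩ := hdel
      have h1 := ih (S.erase i) (F.filter fun v => i ∉ signedSupp v)
        (by rw [Finset.card_erase_of_mem hiS, hS]; rfl)
        (fun v hv => by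
          obtain ⟨hv, hiv⟩ := Finset.mem_filter.1 hv
          obtain ⟨a, b, c⟩ := hF v hv
          exact ⟨Finset.subset_erase.2 ⟨a, fun h => hiv (Finset.mem_union_left _ h)⟩,
            Finset.subset_erase.2 ⟨b, fun h => hiv (Finset.mem_union_right _ h)⟩, c⟩)
        (fun v hv w hw => hcc v (Finset.mem_filter.1 hv).1 w (Finset.mem_filter.1 hw).1)
      have h2 := Finset.card_filter_add_card_filter_not (s := F) fun v => i ∈ signedSupp v
      have h3 := two_mul_choose_add_pVal_le (show 2 ≤ k + l by omega) hn
      omega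
    · push Not at hdel
      refine le_max_of_le_left (Nat.mul_le_mul_left 2 ?_)
      rw [← hS]
      refine card_le_pVal_of_minority (by omega) hl hF hcc (by omega) rfl ?_
      rintro i ⟨u, hu, hiu⟩ ⟨w, hw, hiw⟩
      have hiS := (hF u hu).1 hiu
      have hP : ∀ v ∈ F.filter (fun v => i ∈ v.1), v ∈ F ∧ i ∈ v.1 := fun v hv =>
        Finset.mem_filter.1 hv
      have hQ : ∀ v ∈ F.filter (fun v => i ∈ v.2), v ∈ F ∧ i ∈ v.2 := fun v hv =>
        Finset.mem_filter.1 hv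
      refine (exists_common_or_card_le (P := F.filter fun v => i ∈ v.1)
        (Q := F.filter fun v => i ∈ v.2) (i := i) (fun v hv => hF v (hP v hv).1)
        (fun v hv => hF v (hQ v hv).1) (fun v hv => Finset.mem_union_left _ (hP v hv).2)
        (fun v hv => Finset.mem_union_right _ (hQ v hv).2)
        ⟨w, Finset.mem_filter.2 ⟨hw, hiw⟩⟩ ?_).resolve_left ?_
      · intro v hv x hx
        obtain ⟨hv, hiv⟩ := hP v hv
        obtain ⟨hx, hix⟩ := hQ x hx
        obtain ⟨j, ⟨h1, h2⟩ | ⟨h1, h2⟩⟩ := hcc v hv x hx i hiv hix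
        · exact ⟨j, fun h => Finset.disjoint_left.1 (hF x hx).2.2.1 h2 (h ▸ hix),
            Finset.mem_union_left _ h1, Finset.mem_union_left _ h2⟩
        · exact ⟨j, fun h => Finset.disjoint_left.1 (hF v hv).2.2.1 (h ▸ hiv) h1,
            Finset.mem_union_right _ h1, Finset.mem_union_right _ h2⟩
      · rintro ⟨j, hji, hjP, hjQ⟩
        have := card_le_of_subset_signedSupp (F := F.filter fun v => i ∈ signedSupp v)
          (Z := {i, j}) (fun v hv => hF v (Finset.mem_filter.1 hv).1) (fun v hv => by
            obtain ⟨hv, hiv⟩ := Finset.mem_filter.1 hv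
            rw [Finset.insert_subset_iff, Finset.singleton_subset_iff]
            refine ⟨hiv, ?_⟩
            rcases Finset.mem_union.1 hiv with h | h
            · exact hjP v (Finset.mem_filter.2 ⟨hv, h⟩)
            · exact hjQ v (Finset.mem_filter.2 ⟨hv, h⟩))
        rw [Finset.card_pair hji.symm, hS] at this
        exact absurd this (not_le.2 (hdel i hiS))

end Main

/-- The pair of sets where `v` takes the values `1` and `-1`. -/
def signPair {n : ℕ} (v : Fin n → ℤ) : Finset (Fin n) × Finset (Fin n) :=
  (Finset.univ.filter fun i => v i = 1, Finset.univ.filter fun i => v i = -1)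

lemma mem_signPair_fst {n : ℕ} {v : Fin n → ℤ} {i : Fin n} : i ∈ (signPair v).1 ↔ v i = 1 := by
  simp [signPair]

lemma mem_signPair_snd {n : ℕ} {v : Fin n → ℤ} {i : Fin n} : i ∈ (signPair v).2 ↔ v i = -1 := by
  simp [signPair]

lemma IsPMVec.isSigned_signPair {n k l : ℕ} {v : Fin n → ℤ} (h : IsPMVec n k l v) :
    IsSigned Finset.univ k l (signPair v) := by
  refine ⟨Finset.subset_univ _, Finset.subset_univ _, Finset.disjoint_left.2 fun i h1 h2 => ?_,
    h.2.1, h.2.2⟩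
  rw [mem_signPair_fst] at h1
  rw [mem_signPair_snd] at h2
  omega

lemma IsPMVec.eq_of_signPair_eq {n k l : ℕ} {v w : Fin n → ℤ} (hv : IsPMVec n k l v)
    (hw : IsPMVec n k l w) (h : signPair v = signPair w) : v = w := by
  funext i
  have h1 : v i = 1 ↔ w i = 1 := by rw [← mem_signPair_fst, h, mem_signPair_fst]
  have h2 : v i = -1 ↔ w i = -1 := by rw [← mem_signPair_snd, h, mem_signPair_snd]
  have h3 := hv.1 i
  have h4 := hw.1 i
  omega

lemma IsPMVec.exists_agree_of_dotZ_nonneg {n k l : ℕ} {v w : Fin n → ℤ} (hv : IsPMVec n k l v)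
    (hw : IsPMVec n k l w) (h : 0 ≤ dotZ v w) {i : Fin n} (hvi : v i = 1) (hwi : w i = -1) :
    ∃ j, (v j = 1 ∧ w j = 1) ∨ (v j = -1 ∧ w j = -1) := by
  by_contra! hcon
  refine absurd h (not_le.2 ?_)
  refine Finset.sum_neg' (fun j _ => ?_) ⟨i, Finset.mem_univ i, by simp [hvi, hwi]⟩
  have h1 := hcon j
  rcases hv.1 j with a | a | a <;> rcases hw.1 j with b | b | b <;> simp_all

lemma two_mul_card_le_of_dotZ_nonneg {k l n : ℕ} (hl : 1 ≤ l) (hlk : l < k)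
    (hn : (k + l) * 2 ^ (k + l + 2) ≤ n) {F : Finset (Fin n → ℤ)}
    (hF : ∀ v ∈ F, IsPMVec n k l v) (hdot : ∀ v ∈ F, ∀ w ∈ F, 0 ≤ dotZ v w) :
    2 * F.card ≤ max (2 * pVal n k l)
      (2 * (Nat.choose ((k + l) * 2 ^ (k + l + 2)) k *
        Nat.choose ((k + l) * 2 ^ (k + l + 2)) l) + pVal n k l) := by
  rw [← Finset.card_image_of_injOn (s := F) (f := signPair)
    fun v hv w hw h => (hF v hv).eq_of_signPair_eq (hF w hw) h]
  refine two_mul_card_le hl hlk hn Finset.univ _ (by simp) ?_ ?_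
  · intro x hx
    obtain ⟨v, hv, rfl⟩ := Finset.mem_image.1 hx
    exact (hF v hv).isSigned_signPair
  · intro x hx y hy i hix hiy
    obtain ⟨v, hv, rfl⟩ := Finset.mem_image.1 hx
    obtain ⟨w, hw, rfl⟩ := Finset.mem_image.1 hy
    simp only [mem_signPair_fst, mem_signPair_snd] at hix hiy ⊢
    exact (hF v hv).exists_agree_of_dotZ_nonneg (hF w hw) (hdot v hv w hw) hix hiy

/-- Let `k > l ≥ 1` and `n₀ = (k+l)·2^(k+l+2)`. For every `n ≥ n₀`, one has
`2·m(n,k,l) ≤ max { 2·p(n,k,l), 2·C(n₀,k)·C(n₀,l) + p(n,k,l) }`. -/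
theorem stmt_14 (k l n : ℕ) (hl : 1 ≤ l) (hlk : l < k)
    (hn : (k + l) * 2 ^ (k + l + 2) ≤ n) :
    2 * mVal n k l ≤
      max (2 * pVal n k l)
        (2 * (Nat.choose ((k + l) * 2 ^ (k + l + 2)) k *
          Nat.choose ((k + l) * 2 ^ (k + l + 2)) l) + pVal n k l) := by
  have hmem := Nat.sSup_mem (s := {m | ∃ F : Finset (Fin n → ℤ),
    (∀ v ∈ F, IsPMVec n k l v) ∧ (∀ v ∈ F, ∀ w ∈ F, 0 ≤ dotZ v w) ∧ F.card = m})
    ⟨0, ∅, by simp⟩ ⟨_, by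
      rintro m ⟨F, hF, hdot, rfl⟩
      exact (Nat.le_mul_of_pos_left _ two_pos).trans
        (two_mul_card_le_of_dotZ_nonneg hl hlk hn hF hdot)⟩
  obtain ⟨F, hF, hdot, hcard⟩ := hmem
  rw [mVal, ← hcard]
  exact two_mul_card_le_of_dotZ_nonneg hl hlk hn hF hdot
end

section
/- Let k ≥ ℓ ≥ 1 and n ≥ k+ℓ be integers and let V ⊆ V(n,k,ℓ) be a shifted family such that ⟨v,w⟩ > −2ℓ for all v,w ∈ V. Then every v ∈ V satisfies at least one of: (a) there exists an integer t ≥ 1 with |S_+(v) ∩ [2t−1]| = t; (b) there exists i ∈ [n] with Σ_{j≥i} v_j ≤ −1. -/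
/-- `v` is obtained from `w` by a single `(i ← j)`-shift (`i < j`): the pair
`(w i, w j)` is replaced by `(max (w i) (w j), min (w i) (w j))`. -/
def ShiftStep {n : ℕ} (w v : Fin n → ℤ) : Prop :=
  ∃ i j : Fin n, i < j ∧
    v = Function.update (Function.update w i (max (w i) (w j))) j (min (w i) (w j))

/-- `v ≺ w` in the shifting partial order: `v` is obtained from `w` by a finite
(possibly empty) sequence of `(i ← j)`-shifts. -/
def Precedes {n : ℕ} (v w : Fin n → ℤ) : Prop :=
  Relation.ReflTransGen ShiftStep w v

/-- A finite subset of a linear order has initial segments of every possible size. -/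
theorem exists_initial_segment_card {α : Type*} [LinearOrder α] (Z : Finset α) (c : ℕ)
    (hc : c ≤ Z.card) :
    ∃ Q ⊆ Z, Q.card = c ∧ ∀ x ∈ Q, ∀ y ∈ Z, y ≤ x → y ∈ Q := by
  induction c with
  | zero => exact ⟨∅, by simp, by simp, by simp⟩
  | succ c ih =>
    obtain ⟨Q, hQZ, hcard, hQ⟩ := ih (by omega)
    have hne : (Z \ Q).Nonempty := by
      rw [← Finset.card_pos, Finset.card_sdiff_of_subset hQZ]
      omega
    have hmin := Finset.min'_mem _ hne
    have hle : ∀ y ∈ Z, y ∉ Q → (Z \ Q).min' hne ≤ y := fun y hy hyQ =>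
      Finset.min'_le _ _ (Finset.mem_sdiff.2 ⟨hy, hyQ⟩)
    generalize (Z \ Q).min' hne = a at hmin hle
    rw [Finset.mem_sdiff] at hmin
    refine ⟨insert a Q, Finset.insert_subset hmin.1 hQZ, ?_, ?_⟩
    · rw [Finset.card_insert_of_notMem hmin.2, hcard]
    · intro x hx y hy hyx
      rw [Finset.mem_insert] at hx ⊢
      by_contra! h
      rcases hx with rfl | hx
      · exact h.1 (le_antisymm hyx (hle y hy h.2))
      · exact h.2 (hQ x hx y hy hyx)

/-- Two finite subsets of the same size, of which the second dominates the first on every lower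
set, are matched by an injection that never increases. -/
theorem exists_injective_mem_le {α : Type*} [LinearOrder α] (P Q : Finset α)
    (h : ∀ m, (P.filter (· ≤ m)).card ≤ (Q.filter (· ≤ m)).card) :
    ∃ q : P → α, Function.Injective q ∧ ∀ p, q p ∈ Q ∧ q p ≤ p := by
  have hall : ∀ s : Finset P,
      s.card ≤ (s.biUnion fun p => Q.filter (· ≤ (p : α))).card := by
    intro s
    rcases s.eq_empty_or_nonempty with rfl | hs
    · simp
    calc s.card = (s.map (Function.Embedding.subtype _)).card := (Finset.card_map _).symm
      _ ≤ (P.filter (· ≤ (s.max' hs : α))).card := by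
        refine Finset.card_le_card fun x hx => ?_
        simp only [Finset.mem_map, Function.Embedding.coe_subtype] at hx
        obtain ⟨p, hp, rfl⟩ := hx
        exact Finset.mem_filter.2 ⟨p.2, s.le_max' p hp⟩
      _ ≤ (Q.filter (· ≤ (s.max' hs : α))).card := h _
      _ ≤ _ := Finset.card_le_card
        (Finset.subset_biUnion_of_mem (fun p : P => Q.filter (· ≤ (p : α))) (s.max'_mem hs))
  obtain ⟨q, hq, hqt⟩ := (Finset.all_card_le_biUnion_card_iff_exists_injective _).1 hall
  exact ⟨q, hq, fun p => Finset.mem_filter.1 (hqt p)⟩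

/-- Disjoint pairs `q i < p i` whose right entry is the larger one can be swapped by shifts. -/
theorem exists_precedes_swap {n : ℕ} {ι : Type*} (v : Fin n → ℤ) (q p : ι → Fin n)
    (hq : Function.Injective q) (hp : Function.Injective p) (hqp : ∀ i j, q i ≠ p j)
    (hlt : ∀ i, q i < p i) (hle : ∀ i, v (q i) ≤ v (p i)) (S : Finset ι) :
    ∃ w, Precedes w v ∧ (∀ i ∈ S, w (q i) = v (p i) ∧ w (p i) = v (q i)) ∧
      ∀ i ∉ S, w (q i) = v (q i) ∧ w (p i) = v (p i) := by
  classical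
  induction S using Finset.induction_on with
  | empty => exact ⟨v, Relation.ReflTransGen.refl, by simp, by simp⟩
  | insert a S ha ih =>
    obtain ⟨w, hw, hin, hout⟩ := ih
    refine ⟨_, hw.tail ⟨q a, p a, hlt a, rfl⟩, ?_, ?_⟩
    · intro i hi
      by_cases hia : i = a
      · subst hia
        simp [hqp i i, hout i ha, hle i]
      · have := hin i ((Finset.mem_insert.1 hi).resolve_left hia)
        simp [hqp, (hqp _ _).symm, hq.ne hia, hp.ne hia, this]
    · intro i hi
      rw [Finset.mem_insert, not_or] at hi
      simp [hqp, (hqp _ _).symm, hq.ne hi.1, hp.ne hi.1, hout i hi.2]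

/-- If `|P ∩ [2t-1]| ≠ t` for all `t ≥ 1`, then at most half of each `[m]` lies in `P`. -/
theorem two_mul_card_filter_lt_le {n : ℕ} (P : Finset (Fin n))
    (h : ∀ t : ℕ, 1 ≤ t → (P.filter fun i : Fin n => (i : ℕ) + 1 ≤ 2 * t - 1).card ≠ t) (m : ℕ) :
    2 * (P.filter fun i : Fin n => (i : ℕ) < m).card ≤ m := by
  have hstep : ∀ m : ℕ, (P.filter fun i : Fin n => (i : ℕ) < m + 1).card ≤
      (P.filter fun i : Fin n => (i : ℕ) < m).card + 1 := by
    intro m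
    have hsub : (P.filter fun i : Fin n => (i : ℕ) < m + 1) ⊆
        (P.filter fun i : Fin n => (i : ℕ) < m) ∪ P.filter fun i : Fin n => (i : ℕ) = m := by
      intro i
      simp only [Finset.mem_union, Finset.mem_filter]
      rintro ⟨hi, hlt⟩
      rcases Nat.lt_succ_iff_lt_or_eq.1 hlt with h | h <;> simp [hi, h]
    have hone : (P.filter fun i : Fin n => (i : ℕ) = m).card ≤ 1 := by
      refine Finset.card_le_one.2 fun a ha b hb => Fin.ext ?_
      rw [Finset.mem_filter] at ha hb
      omega
    have := (Finset.card_le_card hsub).trans (Finset.card_union_le _ _)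
    omega
  have hne : ∀ s : ℕ, (P.filter fun i : Fin n => (i : ℕ) < 2 * s + 1).card ≠ s + 1 := by
    intro s
    have := h (s + 1) (by omega)
    rwa [Finset.filter_congr (q := fun i : Fin n => (i : ℕ) < 2 * s + 1)
      (fun i _ => by omega)] at this
  have hodd : ∀ s : ℕ, (P.filter fun i : Fin n => (i : ℕ) < 2 * s + 1).card ≤ s := by
    intro s
    induction s with
    | zero =>
      have h0 := hstep 0
      have h1 := hne 0
      simp only [Nat.not_lt_zero, Finset.filter_false, Finset.card_empty] at h0
      simp only [Nat.mul_zero] at h1 ⊢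
      omega
    | succ s ih =>
      have h1 := hstep (2 * s + 1)
      have h2 := hstep (2 * s + 1 + 1)
      have h3 := hne (s + 1)
      rw [show 2 * (s + 1) + 1 = 2 * s + 1 + 1 + 1 by ring] at h3 ⊢
      omega
  rcases m with _ | m
  · simp
  obtain ⟨s, rfl | rfl⟩ := Nat.even_or_odd' m
  · have := hodd s
    omega
  · have := hodd s
    have := hstep (2 * s + 1)
    omega

/-- The sum of a `{0,1,-1}`-valued function counts its values. -/
theorem sum_eq_card_one_sub_card_neg_one {α : Type*} (v : α → ℤ)
    (hv : ∀ i, v i = 0 ∨ v i = 1 ∨ v i = -1) (s : Finset α) :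
    ∑ i ∈ s, v i = (s.filter fun i => v i = 1).card - (s.filter fun i => v i = -1).card := by
  rw [Finset.card_filter, Finset.card_filter]
  push_cast
  rw [← Finset.sum_sub_distrib]
  refine Finset.sum_congr rfl fun i _ => ?_
  rcases hv i with h | h | h <;> simp [h]

/-- A `{0,1,-1}`-vector violating both alternatives admits a set `Q` of positions outside `S₊(v)`
that contains `S₋(v)`, has the size of `S₊(v)`, and dominates `S₊(v)` on every `[m]`. -/
theorem exists_dominating_set {n k l : ℕ} (hlk : l ≤ k) (v : Fin n → ℤ)
    (hv : IsPMVec n k l v)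
    (hhalf : ∀ m : ℕ,
      2 * ((Finset.univ.filter fun i => v i = 1).filter fun i : Fin n => (i : ℕ) < m).card ≤ m)
    (hsuffix : ∀ i : Fin n, 0 ≤ ∑ j ∈ Finset.univ.filter fun j => i ≤ j, v j) :
    ∃ Q : Finset (Fin n), Q.card = k ∧ (∀ x ∈ Q, v x ≠ 1) ∧ (∀ x, v x = -1 → x ∈ Q) ∧
      ∀ m, ((Finset.univ.filter fun i => v i = 1).filter (· ≤ m)).card ≤
        (Q.filter (· ≤ m)).card := by
  obtain ⟨hval, hk, hl⟩ := hv
  set P := Finset.univ.filter fun i => v i = 1 with hP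
  set N := Finset.univ.filter fun i => v i = -1 with hN
  set Z := Finset.univ.filter fun i => v i = 0 with hZ
  have hPN : Disjoint P N := by
    refine Finset.disjoint_filter.2 fun i _ h1 h2 => ?_
    omega
  have hPNZ : Disjoint (P ∪ N) Z := by
    refine Finset.disjoint_left.2 fun i h1 h2 => ?_
    simp only [hP, hN, hZ, Finset.mem_union, Finset.mem_filter] at h1 h2
    omega
  have hcover : P ∪ N ∪ Z = Finset.univ := by
    ext i
    have := hval i
    simp only [hP, hN, hZ, Finset.mem_union, Finset.mem_filter, Finset.mem_univ, true_and,
      iff_true]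
    omega
  have hsplit : ∀ m : Fin n, (P.filter (· ≤ m)).card + (N.filter (· ≤ m)).card +
      (Z.filter (· ≤ m)).card = m + 1 := by
    intro m
    rw [← Finset.card_union_of_disjoint (Finset.disjoint_filter_filter hPN),
      ← Finset.filter_union, ← Finset.card_union_of_disjoint
      (Finset.disjoint_filter_filter hPNZ), ← Finset.filter_union, hcover,
      Finset.filter_ge_eq_Iic, Fin.card_Iic]
  have hn : k + l + Z.card = n := by
    rw [← hk, ← hl, ← Finset.card_union_of_disjoint hPN,
      ← Finset.card_union_of_disjoint hPNZ, hcover, Finset.card_fin]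
  have h2k : 2 * k ≤ n := by
    have := hhalf n
    rwa [Finset.filter_true_of_mem (fun i _ => i.2), hk] at this
  obtain ⟨Q₀, hQ₀Z, hcard, hinit⟩ := exists_initial_segment_card Z (k - l) (by omega)
  have hNQ₀ : Disjoint N Q₀ :=
    ((Finset.disjoint_union_left.1 hPNZ).2).mono_right hQ₀Z
  refine ⟨N ∪ Q₀, ?_, ?_, ?_, ?_⟩
  · rw [Finset.card_union_of_disjoint hNQ₀, hl, hcard]
    omega
  · intro x hx
    rcases Finset.mem_union.1 hx with h | h
    · rw [(Finset.mem_filter.1 h).2]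
      norm_num
    · rw [(Finset.mem_filter.1 (hQ₀Z h)).2]
      norm_num
  · exact fun x hx => Finset.mem_union_left _ (Finset.mem_filter.2 ⟨Finset.mem_univ x, hx⟩)
  · intro m
    rw [Finset.filter_union,
      Finset.card_union_of_disjoint (Finset.disjoint_filter_filter hNQ₀)]
    by_cases hall : Q₀ ⊆ Finset.univ.filter (· ≤ m)
    · have hQm : Q₀.filter (· ≤ m) = Q₀ :=
        Finset.filter_true_of_mem fun x hx => (Finset.mem_filter.1 (hall hx)).2
      have hPm := Finset.card_filter_add_card_filter_not (s := P) (· ≤ m)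
      have hNm := Finset.card_filter_add_card_filter_not (s := N) (· ≤ m)
      have htail : (N.filter fun i => ¬ i ≤ m).card ≤ (P.filter fun i => ¬ i ≤ m).card := by
        by_cases hm : (m : ℕ) + 1 < n
        · have hs := hsuffix ⟨m + 1, hm⟩
          rw [sum_eq_card_one_sub_card_neg_one v hval, Finset.filter_comm (p := fun j : Fin n => (⟨m + 1, hm⟩ : Fin n) ≤ j)
            (q := fun i => v i = 1),
            Finset.filter_comm (p := fun j : Fin n => (⟨m + 1, hm⟩ : Fin n) ≤ j)
            (q := fun i => v i = -1)] at hs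
          have hiff : ∀ i : Fin n, (⟨m + 1, hm⟩ : Fin n) ≤ i ↔ ¬ i ≤ m := fun i => by
            simp only [Fin.le_def]
            omega
          simp only [hiff] at hs
          change (0 : ℤ) ≤ ((P.filter fun i => ¬ i ≤ m).card : ℤ) -
            (N.filter fun i => ¬ i ≤ m).card at hs
          omega
        · rw [Finset.filter_false_of_mem (s := N)]
          · simp
          · intro i _
            have := i.2
            rw [not_not, Fin.le_def]
            omega
      rw [hQm, hcard]
      omega
    · obtain ⟨x, hx, hxm⟩ := Finset.not_subset.1 hall
      simp only [Finset.mem_filter, Finset.mem_univ, true_and, not_le] at hxm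
      have hZm : (Z.filter (· ≤ m)).card ≤ (Q₀.filter (· ≤ m)).card := by
        refine Finset.card_le_card fun y hy => ?_
        rw [Finset.mem_filter] at hy ⊢
        exact ⟨hinit x hx y hy.1 (hy.2.trans hxm.le), hy.2⟩
      have h1 := hsplit m
      have h2 := hhalf (m + 1)
      simp only [Nat.lt_succ_iff, Fin.val_fin_le] at h2
      omega

/-- Let `k ≥ l ≥ 1`, `n ≥ k + l`, and let `V ⊆ V(n,k,l)` be a shifted family with
`⟨v,w⟩ > -2l` for all `v, w ∈ V`.  Then every `v ∈ V` satisfies: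
(a) `|S₊(v) ∩ [2t-1]| = t` for some integer `t ≥ 1`, or
(b) `Σ_{j ≥ i} v j ≤ -1` for some `i ∈ [n]`.
(Coordinate `i : Fin n` corresponds to the index `i + 1 ∈ [n]`.) -/
theorem stmt_16 (n k l : ℕ) (hl : 1 ≤ l) (hlk : l ≤ k) (hn : k + l ≤ n)
    (V : Finset (Fin n → ℤ)) (hmem : ∀ v ∈ V, IsPMVec n k l v)
    (hshift : ∀ w ∈ V, ∀ v : Fin n → ℤ, Precedes v w → v ∈ V)
    (hdot : ∀ v ∈ V, ∀ w ∈ V, -2 * (l : ℤ) < dotZ v w) :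
    ∀ v ∈ V,
      (∃ t : ℕ, 1 ≤ t ∧
        (Finset.univ.filter fun i : Fin n => v i = 1 ∧ (i : ℕ) + 1 ≤ 2 * t - 1).card
          = t) ∨
      (∃ i : Fin n, (∑ j ∈ Finset.univ.filter fun j => i ≤ j, v j) ≤ -1) := by
  intro v hv
  by_contra! hcon
  obtain ⟨ha, hb⟩ := hcon
  have hpm := hmem v hv
  have hhalf := two_mul_card_filter_lt_le (Finset.univ.filter fun i => v i = 1)
    (fun t ht => by rw [Finset.filter_filter]; exact ha t ht)
  obtain ⟨Q, hQk, hQ1, hQneg, hdom⟩ := exists_dominating_set hlk v hpm hhalf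
    (fun i => by have := hb i; omega)
  obtain ⟨q, hq, hqQ⟩ := exists_injective_mem_le _ Q hdom
  have hp1 : ∀ p : Finset.univ.filter fun i => v i = 1, v p = 1 :=
    fun p => (Finset.mem_filter.1 p.2).2
  have hqp : ∀ i (j : Finset.univ.filter fun i => v i = 1), q i ≠ j := fun i j h => hQ1 _ (hqQ i).1 (h ▸ hp1 j)
  have hle : ∀ i, v (q i) ≤ v i := fun i => by
    have := hp1 i
    have := hpm.1 (q i)
    omega
  obtain ⟨w, hw, hswap, -⟩ := exists_precedes_swap v q Subtype.val hq Subtype.val_injective hqp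
    (fun i => lt_of_le_of_ne (hqQ i).2 (hqp i i)) hle Finset.univ
  have himage : Finset.univ.image q = Q := by
    refine Finset.eq_of_subset_of_card_le (fun x hx => ?_) ?_
    · obtain ⟨i, -, rfl⟩ := Finset.mem_image.1 hx
      exact (hqQ i).1
    · rw [Finset.card_image_of_injective _ hq, Finset.card_univ, Fintype.card_coe, hpm.2.1, hQk]
  have hdisj : Disjoint (Finset.univ.filter fun i => v i = 1) Q :=
    Finset.disjoint_left.2 fun x hx hxQ => hQ1 x hxQ (Finset.mem_filter.1 hx).2
  have hsumQ : ∑ x ∈ Q, v x = -l := by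
    have h1 : Q.filter (fun i => v i = 1) = ∅ := Finset.filter_false_of_mem hQ1
    have h2 : Q.filter (fun i => v i = -1) = Finset.univ.filter fun i => v i = -1 := by
      ext x
      simpa using hQneg x
    rw [sum_eq_card_one_sub_card_neg_one v hpm.1, h1, h2, hpm.2.2]
    simp
  have hwQ : ∑ x ∈ Q, v x * w x = -l := by
    rw [← hsumQ]
    refine Finset.sum_congr rfl fun x hx => ?_
    rw [← himage] at hx
    obtain ⟨i, -, rfl⟩ := Finset.mem_image.1 hx
    rw [(hswap i (Finset.mem_univ i)).1, hp1, mul_one]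
  have hwP : ∑ x ∈ Finset.univ.filter (fun i => v i = 1), v x * w x = -l := by
    rw [← hsumQ, ← himage, Finset.sum_image hq.injOn, ← Finset.sum_coe_sort]
    refine Finset.sum_congr rfl fun i _ => ?_
    rw [(hswap i (Finset.mem_univ i)).2, hp1, one_mul]
  have hdotvw : dotZ v w = -2 * (l : ℤ) := by
    rw [dotZ, ← Finset.sum_subset (Finset.subset_univ
      ((Finset.univ.filter fun i => v i = 1) ∪ Q)), Finset.sum_union hdisj, hwP, hwQ]
    · ring
    · intro x _ hx
      simp only [Finset.mem_union, Finset.mem_filter, Finset.mem_univ, true_and, not_or] at hx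
      have h0 : v x = 0 :=
        (hpm.1 x).resolve_right (not_or.2 ⟨hx.1, fun h => hx.2 (hQneg x h)⟩)
      rw [h0, zero_mul]
  exact (hdot v hv w (hshift v hv w hw)).ne' hdotvw
end

section
/- Let k,ℓ ≥ 1 and n ≥ k+ℓ be integers, and let V ⊆ V(n,k,ℓ) satisfy ⟨v,w⟩ ≥ 0 for all v,w ∈ V. If V contains a vector w with w_n = −1, then |{ v ∈ V : v_n = 1 }| ≤ C(n−1,k−1)·C(n−k,ℓ) − C(n−k−ℓ,k−1)·C(n−2k−ℓ+1,ℓ). -/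
/-- Pairs `(A, B)` of disjoint subsets of `U` with `A` of size `a` and `B` of size `b`. -/
def disjointPairs {α : Type*} [DecidableEq α] (U : Finset α) (a b : ℕ) :
    Finset (Σ _ : Finset α, Finset α) :=
  (U.powersetCard a).sigma fun A => (U \ A).powersetCard b

theorem mem_disjointPairs {α : Type*} [DecidableEq α] {U : Finset α} {a b : ℕ}
    {p : Σ _ : Finset α, Finset α} :
    p ∈ disjointPairs U a b ↔
      (p.1 ⊆ U ∧ p.1.card = a) ∧ p.2 ⊆ U \ p.1 ∧ p.2.card = b := by
  simp [disjointPairs, Finset.mem_powersetCard]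

theorem card_disjointPairs {α : Type*} [DecidableEq α] (U : Finset α) (a b : ℕ) :
    (disjointPairs U a b).card = U.card.choose a * (U.card - a).choose b := by
  rw [disjointPairs, Finset.card_sigma, Finset.sum_congr rfl (g := fun _ => (U.card - a).choose b)]
  · simp
  · intro A hA
    rw [Finset.mem_powersetCard] at hA
    rw [Finset.card_powersetCard, Finset.card_sdiff_of_subset hA.1, hA.2]

theorem disjointPairs_mono {α : Type*} [DecidableEq α] {U W : Finset α} (h : U ⊆ W) (a b : ℕ) :
    disjointPairs U a b ⊆ disjointPairs W a b := by
  intro p hp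
  rw [mem_disjointPairs] at hp ⊢
  exact ⟨⟨hp.1.1.trans h, hp.1.2⟩, hp.2.1.trans (Finset.sdiff_subset_sdiff h subset_rfl), hp.2.2⟩

/-- The positions of `+1` other than `m`, together with the positions of `-1`. -/
def signSupports {n : ℕ} (m : Fin n) (v : Fin n → ℤ) : Σ _ : Finset (Fin n), Finset (Fin n) :=
  ⟨(Finset.univ.filter fun i => v i = 1).erase m, Finset.univ.filter fun i => v i = -1⟩

theorem IsPMVec.card_filter_eq_zero {n k l : ℕ} {w : Fin n → ℤ} (hw : IsPMVec n k l w) :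
    (Finset.univ.filter fun i => w i = 0).card = n - k - l := by
  obtain ⟨h, hk, hl⟩ := hw
  have hd : Disjoint (Finset.univ.filter fun i => w i = 1)
      (Finset.univ.filter fun i => w i = -1) := by
    rw [Finset.disjoint_filter]
    intro i _ h1 h2
    omega
  have he : (Finset.univ.filter fun i => w i = 0) =
      ((Finset.univ.filter fun i => w i = 1) ∪ (Finset.univ.filter fun i => w i = -1))ᶜ := by
    ext i
    simp only [Finset.mem_filter_univ, Finset.mem_compl, Finset.mem_union]
    have := h i
    omega
  rw [he, Finset.card_compl, Finset.card_union_of_disjoint hd, hk, hl, Fintype.card_fin]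
  omega

theorem IsPMVec.signSupports_mem {n k l : ℕ} {m : Fin n} {v : Fin n → ℤ}
    (hv : IsPMVec n k l v) (hm : v m = 1) :
    signSupports m v ∈ disjointPairs (Finset.univ.erase m) (k - 1) l := by
  rw [mem_disjointPairs]
  refine ⟨⟨Finset.erase_subset_erase _ (Finset.subset_univ _), ?_⟩, ?_, hv.2.2⟩
  · rw [signSupports, Finset.card_erase_of_mem (by simpa using hm), hv.2.1]
  · intro i hi
    simp only [signSupports, Finset.mem_filter_univ] at hi
    have him : i ≠ m := by
      rintro rfl
      omega
    simp [signSupports, him, hi]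

theorem signSupports_injOn {n k l : ℕ} (m : Fin n) :
    Set.InjOn (signSupports m) {v | IsPMVec n k l v ∧ v m = 1} := by
  rintro v ⟨hv, hvm⟩ u ⟨hu, hum⟩ h
  simp only [signSupports, Sigma.mk.injEq, heq_eq_eq, Finset.ext_iff, Finset.mem_erase,
    Finset.mem_filter_univ] at h
  funext i
  by_cases him : i = m
  · rw [him, hvm, hum]
  · have h1 := h.1 i
    have h2 := h.2 i
    simp only [ne_eq, him, not_false_eq_true, true_and] at h1
    rcases hv.1 i with h3 | h3 | h3 <;> rcases hu.1 i with h4 | h4 | h4 <;> simp_all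

theorem dotZ_eq_neg_one {n k l : ℕ} {a b : ℕ} {m : Fin n} {v w : Fin n → ℤ}
    (hv : IsPMVec n k l v) (hvm : v m = 1) (hwm : w m = -1)
    (h : signSupports m v ∈ disjointPairs (Finset.univ.filter fun i => w i = 0) a b) :
    dotZ v w = -1 := by
  rw [mem_disjointPairs] at h
  rw [dotZ, Finset.sum_eq_single m, hvm, hwm]
  · norm_num
  · intro i _ him
    rcases hv.1 i with h0 | h1 | h1
    · simp [h0]
    · have := h.1.1 (show i ∈ (signSupports m v).1 by simp [signSupports, him, h1])
      simp [(Finset.mem_filter.mp this).2]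
    · have := (Finset.mem_sdiff.mp
        (h.2.1 (show i ∈ (signSupports m v).2 by simp [signSupports, h1]))).1
      simp [(Finset.mem_filter.mp this).2]
  · simp

/-- Let `k, l ≥ 1`, `n ≥ k + l`, and let `V ⊆ V(n,k,l)` satisfy `⟨v,w⟩ ≥ 0` for all
`v, w ∈ V`.  If `V` contains a vector `w` with `w_n = -1`, then
`|{v ∈ V : v_n = 1}| ≤ C(n-1,k-1)·C(n-k,l) - C(n-k-l,k-1)·C(n-2k-l+1,l)`.
(Coordinate `i : Fin n` corresponds to the index `i + 1 ∈ [n]`, so the last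
coordinate is `n`.) -/
theorem stmt_17 (n k l : ℕ) (hk : 1 ≤ k) (hl : 1 ≤ l) (hn : k + l ≤ n)
    (V : Finset (Fin n → ℤ)) (hmem : ∀ v ∈ V, IsPMVec n k l v)
    (hdot : ∀ v ∈ V, ∀ w ∈ V, 0 ≤ dotZ v w)
    (hw : ∃ w ∈ V, w ⟨n - 1, by omega⟩ = -1) :
    (V.filter fun v => v ⟨n - 1, by omega⟩ = 1).card ≤
      Nat.choose (n - 1) (k - 1) * Nat.choose (n - k) l -
        Nat.choose (n - k - l) (k - 1) * Nat.choose (n + 1 - 2 * k - l) l := by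
  obtain ⟨w, hwV, hwm⟩ := hw
  set m : Fin n := ⟨n - 1, by omega⟩
  have hsub : (Finset.univ.filter fun i => w i = 0) ⊆ Finset.univ.erase m := by
    intro i hi
    rw [Finset.mem_filter_univ] at hi
    refine Finset.mem_erase.mpr ⟨?_, Finset.mem_univ i⟩
    rintro rfl
    omega
  have hcard := Finset.card_sdiff_of_subset (disjointPairs_mono hsub (k - 1) l)
  rw [card_disjointPairs, card_disjointPairs, (hmem w hwV).card_filter_eq_zero,
    Finset.card_erase_of_mem (Finset.mem_univ m), Finset.card_univ, Fintype.card_fin,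
    show n - 1 - (k - 1) = n - k by omega,
    show n - k - l - (k - 1) = n + 1 - 2 * k - l by omega] at hcard
  rw [← hcard]
  refine Finset.card_le_card_of_injOn (signSupports m) ?_ ?_
  · intro v hv
    obtain ⟨hvV, hvm⟩ := Finset.mem_filter.mp hv
    refine Finset.mem_sdiff.mpr ⟨(hmem v hvV).signSupports_mem hvm, fun hbad => ?_⟩
    have := hdot v hvV w hwV
    rw [dotZ_eq_neg_one (hmem v hvV) hvm hwm hbad] at this
    omega
  · refine (signSupports_injOn (k := k) (l := l) m).mono fun v hv => ?_
    obtain ⟨hvV, hvm⟩ := Finset.mem_filter.mp hv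
    exact ⟨hmem v hvV, hvm⟩
end
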